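/- arXiv:1904.06311 — 2 statements merged into one kernel-verified Lean document; each statement's English description precedes it below -/
import Mathlib

section
/- Let φ : [0,∞) → ℝ be a CMF with φ(0) = 1 and lim_{x→∞} φ(x) = 0, let 0 < p ≤ 1 and D ≥ 1. Then the function ω ↦ φ(‖ω‖_p^p) on ℝ^D is positive definite: for every k ≥ 1, every family of pairwise distinct points θ_1,…,θ_k ∈ ℝ^D, and every nonzero vector c ∈ ℂ^k, one has c^H G c > 0 (in particular c^H G c is a positive real number), where G ∈ ℝ^{k×k} is the matrix with entries G[ℓ,ℓ'] = φ(‖θ_ℓ − θ_{ℓ'}‖_p^p) and c^H denotes the conjugate transpose of c. -/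
/-- `φ` is a completely monotone function (CMF) on `[0,∞)`: infinitely differentiable
on `(0,∞)`, right-continuous at `0`, with `(-1)^n φ^(n)(x) ≥ 0` for all `x > 0`, `n ∈ ℕ`. -/
def IsCMF (φ : ℝ → ℝ) : Prop :=
  ContDiffOn ℝ (⊤ : ℕ∞) φ (Set.Ioi 0) ∧
  ContinuousWithinAt φ (Set.Ici 0) 0 ∧
  ∀ (n : ℕ) (x : ℝ), 0 < x → 0 ≤ (-1 : ℝ) ^ n * iteratedDeriv n φ x

/-- `‖x‖_p^p = Σ_d |x[d]|^p` on `ℝ^D`. -/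
noncomputable def pPowSum {D : ℕ} (p : ℝ) (x : Fin D → ℝ) : ℝ := ∑ d, |x d| ^ p


open Polynomial in
/-- Linear functional on polynomials with `X^m ↦ f (m h)`. -/
noncomputable def momL (h : ℝ) (f : ℝ → ℝ) : ℝ[X] →ₗ[ℝ] ℝ :=
  (Polynomial.basisMonomials ℝ).constr ℝ (fun m : ℕ => f (m * h))

open Polynomial in
lemma momL_X_pow (h : ℝ) (f : ℝ → ℝ) (m : ℕ) : momL h f (X ^ m) = f (m * h) := by
  have := (Polynomial.basisMonomials ℝ).constr_basis ℝ (fun m : ℕ => f (m * h)) m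
  rw [Polynomial.coe_basisMonomials] at this
  rw [← Polynomial.monomial_one_right_eq_X_pow]
  exact this

open Polynomial in
lemma momL_mul_one_sub (h : ℝ) (f : ℝ → ℝ) (q : ℝ[X]) :
    momL h f (q * (1 - X)) = momL h (fun x => f x - f (x + h)) q := by
  induction q using Polynomial.induction_on' with
  | add p q hp hq => rw [add_mul, map_add, map_add, hp, hq]
  | monomial n a =>
    rw [← Polynomial.smul_X_eq_monomial, smul_mul_assoc, map_smul, map_smul, mul_sub, mul_one,
      ← pow_succ, map_sub, momL_X_pow, momL_X_pow, momL_X_pow]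
    push_cast
    rw [add_mul, one_mul]

lemma IsCMF.contDiffAt {f : ℝ → ℝ} (hf : IsCMF f) {x : ℝ} (hx : 0 < x) (n : ℕ) :
    ContDiffAt ℝ n f x :=
  ((hf.1.contDiffAt (Ioi_mem_nhds hx)).of_le (by exact_mod_cast le_top))

lemma IsCMF.nonneg {f : ℝ → ℝ} (hf : IsCMF f) {x : ℝ} (hx : 0 ≤ x) : 0 ≤ f x := by
  have h1 : ∀ y, 0 < y → 0 ≤ f y := fun y hy => by simpa using hf.2.2 0 y hy
  rcases hx.lt_or_eq with h | rfl
  · exact h1 x h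
  · have h2 : Filter.Tendsto f (nhdsWithin 0 (Set.Ioi 0)) (nhds (f 0)) :=
      hf.2.1.mono_left (nhdsWithin_mono _ Set.Ioi_subset_Ici_self)
    exact ge_of_tendsto h2 (Filter.eventually_of_mem self_mem_nhdsWithin h1)

lemma IsCMF.hasDerivAt {f : ℝ → ℝ} (hf : IsCMF f) {x : ℝ} (hx : 0 < x) (n : ℕ) :
    HasDerivAt (iteratedDeriv n f) (iteratedDeriv (n + 1) f x) x := by
  rw [iteratedDeriv_succ]
  apply DifferentiableAt.hasDerivAt
  have h1 := (contDiffWithinAt_univ.mpr (hf.contDiffAt hx (n + 1))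
    ).differentiableWithinAt_iteratedDerivWithin (m := n) (by norm_cast; simp)
    (by simp)
  rw [iteratedDerivWithin_univ] at h1
  exact differentiableWithinAt_univ.mp h1

lemma IsCMF.anti {f : ℝ → ℝ} (hf : IsCMF f) (n : ℕ) :
    AntitoneOn (fun x => (-1 : ℝ) ^ n * iteratedDeriv n f x) (Set.Ioi 0) := by
  have hd : ∀ x ∈ Set.Ioi (0 : ℝ), HasDerivAt (fun x => (-1 : ℝ) ^ n * iteratedDeriv n f x)
      ((-1 : ℝ) ^ n * iteratedDeriv (n + 1) f x) x :=
    fun x hx => (hf.hasDerivAt hx n).const_mul _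
  apply antitoneOn_of_deriv_nonpos (convex_Ioi 0)
  · exact fun x hx => (hd x hx).continuousAt.continuousWithinAt
  · rw [interior_Ioi]
    exact fun x hx => (hd x hx).differentiableAt.differentiableWithinAt
  · rw [interior_Ioi]
    intro x hx
    rw [(hd x hx).deriv]
    have := hf.2.2 (n + 1) x hx
    rw [pow_succ] at this
    linarith

lemma IsCMF.diff {f : ℝ → ℝ} (hf : IsCMF f) {h : ℝ} (hh : 0 < h) :
    IsCMF (fun x => f x - f (x + h)) := by
  refine ⟨?_, ?_, ?_⟩
  · apply hf.1.sub
    apply hf.1.comp (by fun_prop)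
    intro x hx
    simp only [Set.mem_Ioi] at *
    linarith
  · apply hf.2.1.sub
    have h1 : ContinuousAt f (0 + h) := by
      rw [zero_add]; exact (hf.contDiffAt hh 0).continuousAt
    exact (ContinuousAt.comp (f := fun x : ℝ => x + h) (x := (0:ℝ)) h1 (by fun_prop)).continuousWithinAt
  · intro n x hx
    have hxh : 0 < x + h := by linarith
    have hc : ContDiffAt ℝ n (fun x => f (x + h)) x :=
      ContDiffAt.comp x (f := fun x => x + h) (hf.contDiffAt hxh n) (by fun_prop)
    rw [iteratedDeriv_fun_sub (hf.contDiffAt hx n) hc, iteratedDeriv_comp_add_const, mul_sub, sub_nonneg]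
    exact hf.anti n hx hxh (by linarith)

open Polynomial in
lemma momL_nonneg {h : ℝ} (hh : 0 < h) (k j : ℕ) : ∀ {f : ℝ → ℝ}, IsCMF f →
    0 ≤ momL h f (X ^ j * (1 - X) ^ k) := by
  induction k with
  | zero => intro f hf; rw [pow_zero, mul_one, momL_X_pow]; exact hf.nonneg (by positivity)
  | succ k ih =>
    intro f hf
    rw [pow_succ, ← mul_assoc, momL_mul_one_sub]
    exact ih (hf.diff hh)

open Polynomial in
lemma bern_nonneg {h : ℝ} (hh : 0 < h) (N j : ℕ) {f : ℝ → ℝ} (hf : IsCMF f) :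
    0 ≤ momL h f (bernsteinPolynomial ℝ N j) := by
  rw [bernsteinPolynomial, mul_assoc, ← Polynomial.C_eq_natCast, ← Polynomial.smul_eq_C_mul,
    map_smul]
  exact mul_nonneg (Nat.cast_nonneg _) (momL_nonneg hh _ _ hf)

open Polynomial in
lemma bern_choose (N m : ℕ) (hm : m ≤ N) :
    ∑ j ∈ Finset.range (N + 1), (j.choose m : ℝ) • bernsteinPolynomial ℝ N j
      = (N.choose m : ℝ) • (X ^ m : ℝ[X]) := by
  obtain ⟨M, rfl⟩ := Nat.exists_eq_add_of_le hm
  rw [add_assoc, Finset.sum_range_add, Finset.sum_eq_zero, zero_add]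
  · have key : ∀ x ∈ Finset.range (M + 1),
        ((m + x).choose m : ℝ) • bernsteinPolynomial ℝ (m + M) (m + x)
          = ((m + M).choose m : ℝ) • (X ^ m * (X ^ x * (1 - X) ^ (M - x) * (M.choose x : ℝ[X]))) := by
      intro x hx
      have h1 := Nat.choose_mul (n := m + M) (k := m + x) (s := m) (by omega)
      rw [show m + M - m = M by omega, show m + x - m = x by omega] at h1
      have h2 : (((m + M).choose (m + x) : ℝ[X]) * ((m+x).choose m : ℝ[X])) =
        ((m + M).choose m : ℝ[X]) * (M.choose x : ℝ[X]) := by exact_mod_cast h1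
      rw [bernsteinPolynomial, show m + M - (m + x) = M - x by omega, smul_eq_C_mul, smul_eq_C_mul,
        C_eq_natCast, C_eq_natCast, pow_add]
      linear_combination (X ^ m * X ^ x * (1 - X) ^ (M - x)) * h2
    rw [Finset.sum_congr rfl key, ← Finset.smul_sum, ← Finset.mul_sum, ← add_pow]
    simp
  · intro j hj
    rw [Nat.choose_eq_zero_of_lt (Finset.mem_range.mp hj)]
    simp

lemma choose_ratio (N j m : ℕ) (hj : j ≤ N) (hm : m ≤ N) (hN : 0 < N) :
    |(j.choose m : ℝ) / (N.choose m) - ((j : ℝ) / N) ^ m| ≤ (m : ℝ) ^ 2 / N := by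
  have hN' : (0 : ℝ) < N := by exact_mod_cast hN
  have hjN : (j : ℝ) ≤ N := by exact_mod_cast hj
  induction m with
  | zero => simp
  | succ m ih =>
    specialize ih (by omega)
    have hmN : (m : ℝ) + 1 ≤ N := by exact_mod_cast hm
    have hb : ((j.choose (m+1) : ℝ)) / (N.choose (m+1)) =
        (j.choose m : ℝ) / (N.choose m) * (((j - m : ℕ) : ℝ) / ((N : ℝ) - m)) := by
      have e1 : ((j.choose (m+1) : ℝ)) * (m + 1) = j.choose m * ((j - m : ℕ) : ℝ) := by
        exact_mod_cast Nat.choose_succ_right_eq j m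
      have e2 : ((N.choose (m+1) : ℝ)) * (m + 1) = N.choose m * ((N : ℝ) - m) := by
        have := Nat.choose_succ_right_eq N m
        rw [← Nat.cast_sub (by omega)]
        exact_mod_cast this
      have p1 : (0:ℝ) < N.choose m := by exact_mod_cast Nat.choose_pos (by omega)
      have p2 : (0:ℝ) < N.choose (m+1) := by exact_mod_cast Nat.choose_pos hm
      have p3 : (0:ℝ) < (N : ℝ) - m := by linarith
      rw [div_mul_div_comm, ← e1, ← e2, mul_div_mul_right _ _ (by positivity)]
    rw [hb, pow_succ]
    set a := (j.choose m : ℝ) / (N.choose m)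
    set b := ((j : ℝ) / N) ^ m
    set u := (((j - m : ℕ) : ℝ) / ((N : ℝ) - m))
    set v := (j : ℝ) / N
    have p3 : (0:ℝ) < (N : ℝ) - m := by linarith
    have hu0 : 0 ≤ u := by positivity
    have hu1 : u ≤ 1 := by
      rw [div_le_one p3, ← Nat.cast_sub (by omega)]
      exact_mod_cast (by omega)
    have hv0 : 0 ≤ v := by positivity
    have hv1 : v ≤ 1 := by rw [div_le_one hN']; exact hjN
    have hb0 : 0 ≤ b := by positivity
    have hb1 : b ≤ 1 := pow_le_one₀ hv0 hv1
    have huv : |u - v| ≤ (m : ℝ) / N := by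
      rcases le_or_gt m j with hmj | hmj
      · have hmj' : (m : ℝ) ≤ j := by exact_mod_cast hmj
        have : u - v = -(m / N * ((N - j) / (N - m))) := by
          simp only [u, v]
          rw [Nat.cast_sub hmj]
          field_simp
          ring
        rw [this, abs_neg, abs_of_nonneg (by apply mul_nonneg (by positivity); apply div_nonneg <;> linarith)]
        apply mul_le_of_le_one_right (by positivity)
        rw [div_le_one p3]; linarith
      · have : u = 0 := by
          simp only [u]; rw [Nat.sub_eq_zero_of_le hmj.le]; simp
        rw [this, zero_sub, abs_neg, abs_of_nonneg hv0]
        simp only [v]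
        gcongr
    calc |a * u - b * v| = |(a - b) * u + b * (u - v)| := by ring_nf
      _ ≤ |(a - b) * u| + |b * (u - v)| := abs_add_le _ _
      _ = |a - b| * u + b * |u - v| := by rw [abs_mul, abs_mul, abs_of_nonneg hu0, abs_of_nonneg hb0]
      _ ≤ (m:ℝ)^2 / N * 1 + 1 * (m / N) := by gcongr
      _ ≤ ((m + 1 : ℕ) : ℝ) ^ 2 / N := by
        rw [mul_one, one_mul, ← add_div]
        push_cast
        gcongr
        nlinarith [(Nat.cast_nonneg m : (0:ℝ) ≤ m)]

open Polynomial in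
/-- Hausdorff-type positivity on a grid. -/
lemma grid_pos {ι : Type*} [Fintype ι] {h : ℝ} (hh : 0 < h) {f : ℝ → ℝ} (hf : IsCMF f)
    (a : ι → ℝ) (m : ι → ℕ) (hP : ∀ u : ℝ, 0 ≤ u → u ≤ 1 → 0 ≤ ∑ i, a i * u ^ m i) :
    0 ≤ ∑ i, a i * f (m i * h) := by
  set K := ∑ i, |a i| * (m i : ℝ) ^ 2
  have hlim : Filter.Tendsto (fun N : ℕ => -(K * f 0) / (N : ℝ)) Filter.atTop (nhds 0) :=
    tendsto_const_div_atTop_nhds_zero_nat _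
  refine le_of_tendsto hlim ?_
  filter_upwards [Filter.eventually_gt_atTop 0, Filter.eventually_ge_atTop (∑ i, m i)] with N hN hNm
  have hmi : ∀ i, m i ≤ N := fun i =>
    (Finset.single_le_sum (f := m) (fun _ _ => Nat.zero_le _) (Finset.mem_univ i)).trans hNm
  set w : ℕ → ℝ := fun j => momL h f (bernsteinPolynomial ℝ N j)
  have hw : ∀ j, 0 ≤ w j := fun j => bern_nonneg hh N j hf
  have hmom : ∀ n ≤ N, f (n * h) =
      ∑ j ∈ Finset.range (N + 1), w j * ((j.choose n : ℝ) / N.choose n) := by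
    intro n hn
    have h1 := congrArg (momL h f) (bern_choose N n hn)
    rw [map_sum, map_smul, momL_X_pow] at h1
    simp only [map_smul, smul_eq_mul] at h1
    have p1 : (0:ℝ) < N.choose n := by exact_mod_cast Nat.choose_pos hn
    simp_rw [← mul_div_assoc]
    rw [← Finset.sum_div, eq_div_iff p1.ne', mul_comm, ← h1]
    exact Finset.sum_congr rfl fun j _ => mul_comm _ _
  have hw1 : ∑ j ∈ Finset.range (N + 1), w j = f 0 := by
    have := hmom 0 (Nat.zero_le _)
    simp at this
    exact this.symm
  have : ∑ i, a i * f (m i * h) = ∑ j ∈ Finset.range (N + 1), w j *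
      ∑ i, a i * ((j.choose (m i) : ℝ) / N.choose (m i)) := by
    simp_rw [Finset.mul_sum]
    rw [Finset.sum_comm]
    refine Finset.sum_congr rfl fun i _ => ?_
    rw [hmom _ (hmi i), Finset.mul_sum]
    exact Finset.sum_congr rfl fun j _ => by ring
  rw [this]
  have hN' : (0 : ℝ) < N := by exact_mod_cast hN
  calc -(K * f 0) / (N : ℝ) = ∑ j ∈ Finset.range (N + 1), w j * (-(K / N)) := by
        rw [← Finset.sum_mul, hw1]; ring
    _ ≤ _ := by
      refine Finset.sum_le_sum fun j hj => mul_le_mul_of_nonneg_left ?_ (hw j)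
      have hj' : j ≤ N := by have := Finset.mem_range.mp hj; omega
      have h1 := hP ((j : ℝ) / N) (by positivity) (by rw [div_le_one hN']; exact_mod_cast hj')
      have h2 : |∑ i, a i * ((j.choose (m i) : ℝ) / N.choose (m i)) - ∑ i, a i * ((j : ℝ) / N) ^ m i|
          ≤ K / N := by
        rw [← Finset.sum_sub_distrib, Finset.sum_div]
        refine (Finset.abs_sum_le_sum_abs _ _).trans (Finset.sum_le_sum fun i _ => ?_)
        rw [← mul_sub, abs_mul, mul_div_assoc]
        exact mul_le_mul_of_nonneg_left (choose_ratio N j (m i) hj' (hmi i) hN) (abs_nonneg _)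
      have := (abs_le.mp h2).1
      linarith

lemma exp_diff_bound {x y t : ℝ} (hy : 0 < y) (hyx : y ≤ x) (ht : 0 ≤ t) :
    |Real.exp (-t * y) - Real.exp (-t * x)| ≤ (x - y) / y := by
  have h1 : Real.exp (-t * x) = Real.exp (-t * y) * Real.exp (-(t * (x - y))) := by
    rw [← Real.exp_add]; ring_nf
  have h0 : 0 ≤ t * (x - y) := mul_nonneg ht (by linarith)
  have h2 : 1 - t * (x - y) ≤ Real.exp (-(t * (x - y))) := by
    have := Real.add_one_le_exp (-(t * (x - y))); linarith
  have h3 : Real.exp (-(t * (x - y))) ≤ 1 := Real.exp_le_one_iff.mpr (by linarith)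
  have h4 : t * y * Real.exp (-t * y) ≤ 1 := by
    have := Real.add_one_le_exp (t * y)
    have h5 : Real.exp (t * y) * Real.exp (-t * y) = 1 := by
      rw [← Real.exp_add]; simp
    have := Real.exp_pos (-t * y)
    nlinarith
  have hE := Real.exp_pos (-t * y)
  rw [h1, abs_of_nonneg (by nlinarith), le_div_iff₀ hy]
  calc (Real.exp (-t * y) - Real.exp (-t * y) * Real.exp (-(t * (x - y)))) * y
      = (1 - Real.exp (-(t * (x - y)))) * (Real.exp (-t * y) * y) := by ring
    _ ≤ (t * (x - y)) * (Real.exp (-t * y) * y) := by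
        apply mul_le_mul_of_nonneg_right (by linarith) (by positivity)
    _ = (t * y * Real.exp (-t * y)) * (x - y) := by ring
    _ ≤ 1 * (x - y) := by apply mul_le_mul_of_nonneg_right h4 (by linarith)
    _ = x - y := one_mul _

lemma IsCMF.continuousWithinAt {f : ℝ → ℝ} (hf : IsCMF f) {x : ℝ} (hx : 0 ≤ x) :
    ContinuousWithinAt f (Set.Ici 0) x := by
  rcases hx.lt_or_eq with h | rfl
  · exact (hf.contDiffAt h 0).continuousAt.continuousWithinAt
  · exact hf.2.1

/-- Positivity of the Laplace functional of a CMF. -/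
lemma laplace_pos {ι : Type*} [Fintype ι] {f : ℝ → ℝ} (hf : IsCMF f)
    (a x : ι → ℝ) (hx : ∀ i, 0 ≤ x i)
    (hP : ∀ t : ℝ, 0 ≤ t → 0 ≤ ∑ i, a i * Real.exp (-t * x i)) :
    0 ≤ ∑ i, a i * f (x i) := by
  set h : ℕ → ℝ := fun n => 1 / ((n : ℝ) + 1) with hh
  have hpos : ∀ n, 0 < h n := fun n => by simp only [hh]; positivity
  have hlim : Filter.Tendsto h Filter.atTop (nhds 0) := tendsto_one_div_add_atTop_nhds_zero_nat
  set m : ℕ → ι → ℕ := fun n i => ⌊x i / h n⌋₊ with hm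
  have hle : ∀ n i, (m n i : ℝ) * h n ≤ x i := fun n i => by
    rw [← le_div_iff₀ (hpos n)]
    exact Nat.floor_le (div_nonneg (hx i) (hpos n).le)
  have hge : ∀ n i, x i - h n ≤ (m n i : ℝ) * h n := fun n i => by
    have := Nat.lt_floor_add_one (x i / h n)
    rw [div_lt_iff₀ (hpos n)] at this
    simp only [hm]
    linarith
  have hy : ∀ i, Filter.Tendsto (fun n => (m n i : ℝ) * h n) Filter.atTop (nhds (x i)) := fun i => by
    refine tendsto_of_tendsto_of_tendsto_of_le_of_le (g := fun n => x i - h n) (h := fun _ => x i) ?_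
      tendsto_const_nhds (fun n => hge n i) (fun n => hle n i)
    simpa using hlim.const_sub (x i)
  set e : ℕ → ι → ℝ := fun n i => (x i - m n i * h n) / (m n i * h n) with he
  have hy0 : ∀ i, x i = 0 → ∀ n, (m n i : ℝ) * h n = 0 := fun i hi n => by
    have h1 := hle n i
    have h2 : 0 ≤ (m n i : ℝ) * h n := mul_nonneg (Nat.cast_nonneg _) (hpos n).le
    linarith
  have helim : ∀ i, Filter.Tendsto (fun n => e n i) Filter.atTop (nhds 0) := fun i => by
    by_cases hi : x i = 0
    · have : (fun n => e n i) = fun _ => 0 := by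
        funext n; simp only [he]; rw [hy0 i hi n, div_zero]
      rw [this]; exact tendsto_const_nhds
    · have := ((hy i).const_sub (x i)).div (hy i) hi
      rw [sub_self, zero_div] at this
      exact this
  have hev : ∀ᶠ n in Filter.atTop, ∀ i, x i = 0 ∨ 0 < (m n i : ℝ) * h n := by
    rw [Filter.eventually_all]
    intro i
    by_cases hi : x i = 0
    · exact Filter.Eventually.of_forall fun n => Or.inl hi
    · have : 0 < x i := lt_of_le_of_ne (hx i) (Ne.symm hi)
      filter_upwards [(hy i).eventually (lt_mem_nhds this)] with n hn using Or.inr hn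
  have hfin : Filter.Tendsto (fun n => ∑ i, a i * f (m n i * h n) + (∑ i, |a i| * e n i) * f 0)
      Filter.atTop (nhds (∑ i, a i * f (x i) + (∑ i, |a i| * 0) * f 0)) := by
    refine Filter.Tendsto.add ?_ (Filter.Tendsto.mul_const _ ?_)
    · refine tendsto_finsetSum _ fun i _ => Filter.Tendsto.const_mul _ ?_
      refine (hf.continuousWithinAt (hx i)).tendsto.comp ?_
      refine tendsto_nhdsWithin_iff.mpr ⟨hy i, Filter.Eventually.of_forall fun n => ?_⟩
      exact mul_nonneg (Nat.cast_nonneg _) (hpos n).le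
    · exact tendsto_finsetSum _ fun i _ => (helim i).const_mul _
  have hgoal : ∑ i, a i * f (x i) = ∑ i, a i * f (x i) + (∑ i, |a i| * 0) * f 0 := by simp
  rw [hgoal]
  refine ge_of_tendsto hfin ?_
  filter_upwards [hev] with n hn
  have hpos1 : ∀ u : ℝ, 0 < u → u ≤ 1 → 0 ≤ ∑ i, a i * u ^ m n i + ∑ i, |a i| * e n i := by
    intro u hu hu1
    set t := -Real.log u / h n with ht
    have ht0 : 0 ≤ t := div_nonneg (by have := Real.log_nonpos hu.le hu1; linarith) (hpos n).le
    have hut : ∀ i, u ^ m n i = Real.exp (-t * (m n i * h n)) := fun i => by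
      have : -t * (m n i * h n) = m n i * Real.log u := by
        rw [ht]; field_simp [(hpos n).ne']
      rw [this, Real.exp_nat_mul, Real.exp_log hu]
    have h1 := hP t ht0
    have h2 : |∑ i, a i * u ^ m n i - ∑ i, a i * Real.exp (-t * x i)| ≤ ∑ i, |a i| * e n i := by
      rw [← Finset.sum_sub_distrib]
      refine (Finset.abs_sum_le_sum_abs _ _).trans (Finset.sum_le_sum fun i _ => ?_)
      rw [← mul_sub, abs_mul, hut]
      refine mul_le_mul_of_nonneg_left ?_ (abs_nonneg _)
      rcases hn i with hi | hi
      · simp only [he]; rw [hy0 i hi n, hi]; simp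
      · exact exp_diff_bound hi (hle n i) ht0
    have := (abs_le.mp h2).1
    linarith
  have := grid_pos (ι := Option ι) (hpos n) hf
    (fun o => o.elim (∑ i, |a i| * e n i) a) (fun o => o.elim 0 (m n)) ?_
  · simp only [Fintype.sum_option, Option.elim] at this
    simp only [Nat.cast_zero, zero_mul] at this
    linarith
  · intro u hu hu1
    simp only [Fintype.sum_option, Option.elim, pow_zero, mul_one]
    rcases hu.lt_or_eq with hu | rfl
    · have := hpos1 u hu hu1; linarith
    · have hc : Continuous (fun u : ℝ => ∑ i, |a i| * e n i + ∑ i, a i * u ^ m n i) := by fun_prop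
      have hc' := (hc.tendsto 0).mono_left (nhdsWithin_le_nhds (s := Set.Ioi 0))
      refine ge_of_tendsto hc' ?_
      filter_upwards [Ioo_mem_nhdsGT (show (0:ℝ) < 1 by norm_num)] with u hu
      have := hpos1 u hu.1 hu.2.le
      linarith

/-- Strictly positive definite kernels. -/
def SPD {α : Type} (K : α → α → ℝ) : Prop :=
  ∀ (ι : Type) [Fintype ι] (x : ι → α), Function.Injective x →
    (Matrix.of fun i j => K (x i) (x j)).PosDef

lemma SPD.comp {α β : Type} {K : β → β → ℝ} (hK : SPD K) (g : α → β) (hg : Function.Injective g) :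
    SPD (fun x y => K (g x) (g y)) :=
  fun ι _ x hx => hK ι (g ∘ x) (hg.comp hx)

open scoped Kronecker in
lemma SPD.prod {α β : Type} {K : α → α → ℝ} {M : β → β → ℝ} (hK : SPD K) (hM : SPD M) :
    SPD (fun x y : α × β => K x.1 y.1 * M x.2 y.2) := by
  classical
  intro ι _ x hx
  have h1 := hK (Set.range fun i => (x i).1) Subtype.val Subtype.val_injective
  have h2 := hM (Set.range fun i => (x i).2) Subtype.val Subtype.val_injective
  have h3 := h1.kronecker h2
  let s : ι → (Set.range fun i => (x i).1) × (Set.range fun i => (x i).2) :=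
    fun i => (⟨(x i).1, i, rfl⟩, ⟨(x i).2, i, rfl⟩)
  have hs : Function.Injective s := by
    intro i j hij
    simp only [s, Prod.mk.injEq] at hij
    exact hx (Prod.ext (congrArg Subtype.val hij.1) (congrArg Subtype.val hij.2))
  exact h3.submatrix hs

lemma posDef_iff_sum {ι : Type} [Fintype ι] (A : Matrix ι ι ℝ) :
    A.PosDef ↔ A.IsHermitian ∧ ∀ c : ι → ℝ, c ≠ 0 → 0 < ∑ i, ∑ j, c i * c j * A i j := by
  rw [Matrix.posDef_iff_dotProduct_mulVec]
  refine and_congr_right fun _ => ?_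
  have : ∀ c : ι → ℝ, star c ⬝ᵥ (A.mulVec c) = ∑ i, ∑ j, c i * c j * A i j := by
    intro c
    simp only [dotProduct, Matrix.mulVec, Finset.mul_sum, Pi.star_apply, star_trivial]
    exact Finset.sum_congr rfl fun i _ => Finset.sum_congr rfl fun j _ => by ring
  simp only [this]

lemma min_form (S : Finset ℝ) : ∀ (g : ℝ → ℝ), StrictMono g → (∀ x ∈ S, 0 < g x) →
    ∀ c : ℝ → ℝ, (∃ x ∈ S, c x ≠ 0) → 0 < ∑ x ∈ S, ∑ y ∈ S, c x * c y * g (min x y) := by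
  induction S using Finset.induction_on_min with
  | empty => rintro g - - c ⟨x, hx, -⟩; simp at hx
  | insert a S ha ih =>
    intro g hg hpos c hc
    have haS : a ∉ S := fun h => lt_irrefl _ (ha a h)
    have hga := hpos a (Finset.mem_insert_self _ _)
    set T := ∑ x ∈ S, ∑ y ∈ S, c x * c y * (g (min x y) - g a) with hT
    have hT' : T = ∑ x ∈ S, ∑ y ∈ S, c x * c y * g (min x y) - g a * (∑ x ∈ S, c x) ^ 2 := by
      rw [hT, sq, Finset.sum_mul_sum, Finset.mul_sum, ← Finset.sum_sub_distrib]
      refine Finset.sum_congr rfl fun x _ => ?_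
      rw [Finset.mul_sum, ← Finset.sum_sub_distrib]
      exact Finset.sum_congr rfl fun y _ => by ring
    have e1 : ∑ y ∈ S, c a * c y * g (min a y) = c a * g a * ∑ y ∈ S, c y := by
      rw [Finset.mul_sum]
      exact Finset.sum_congr rfl fun y hy => by rw [min_eq_left (ha y hy).le]; ring
    have e2 : ∑ x ∈ S, c x * c a * g (min x a) = c a * g a * ∑ y ∈ S, c y := by
      rw [Finset.mul_sum]
      exact Finset.sum_congr rfl fun y hy => by rw [min_eq_right (ha y hy).le]; ring
    have hmain : ∑ x ∈ insert a S, ∑ y ∈ insert a S, c x * c y * g (min x y) =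
        g a * (c a + ∑ x ∈ S, c x) ^ 2 + T := by
      rw [hT', Finset.sum_insert haS, Finset.sum_insert haS, e1]
      simp_rw [Finset.sum_insert haS]
      rw [Finset.sum_add_distrib, e2, min_self]
      ring
    rw [hmain]
    by_cases hS : ∃ x ∈ S, c x ≠ 0
    · have := ih (fun x => g x - g a) (fun x y hxy => by have := hg hxy; simp only; linarith)
        (fun x hx => by have := hg (ha x hx); linarith) c hS
      have h2 : 0 ≤ g a * (c a + ∑ x ∈ S, c x) ^ 2 := by positivity
      linarith
    · push Not at hS
      have hT0 : T = 0 := Finset.sum_eq_zero fun x hx => Finset.sum_eq_zero fun y _ => by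
        rw [hS x hx]; ring
      have hs0 : ∑ x ∈ S, c x = 0 := Finset.sum_eq_zero hS
      have hca : c a ≠ 0 := by
        obtain ⟨x, hx, hcx⟩ := hc
        rcases Finset.mem_insert.mp hx with rfl | hx
        · exact hcx
        · exact absurd (hS x hx) hcx
      rw [hT0, hs0, add_zero, add_zero]
      positivity

lemma spd_laplace (t : ℝ) (ht : 0 < t) : SPD (fun x y : ℝ => Real.exp (-t * |x - y|)) := by
  classical
  intro ι _ x hx
  rw [posDef_iff_sum]
  constructor
  · ext i j; simp [abs_sub_comm]
  intro c hc
  obtain ⟨i₀, hi₀⟩ := Function.ne_iff.mp hc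
  have key := min_form (Finset.univ.image x) (fun z => Real.exp (2 * t * z))
    (fun a b hab => Real.exp_lt_exp.mpr (by nlinarith)) (fun _ _ => Real.exp_pos _)
    (fun z => Real.exp (-t * z) * Function.extend x c 0 z)
    ⟨x i₀, by simp, by rw [hx.extend_apply]; exact mul_ne_zero (Real.exp_pos _).ne' hi₀⟩
  rw [Finset.sum_image hx.injOn] at key
  simp_rw [Finset.sum_image hx.injOn, hx.extend_apply] at key
  refine key.trans_eq (Finset.sum_congr rfl fun i _ => Finset.sum_congr rfl fun j _ => ?_)
  simp only [Matrix.of_apply]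
  have : Real.exp (-t * |x i - x j|) =
      Real.exp (-t * x i) * Real.exp (-t * x j) * Real.exp (2 * t * min (x i) (x j)) := by
    rw [← Real.exp_add, ← Real.exp_add]
    congr 1
    rcases le_total (x i) (x j) with h | h
    · rw [min_eq_left h, abs_of_nonpos (by linarith)]; ring
    · rw [min_eq_right h, abs_of_nonneg (by linarith)]; ring
  rw [this]; ring

lemma spd_of_cmf {α : Type} (d : α → α → ℝ) (hsymm : ∀ x y, d x y = d y x)
    (hd0 : ∀ x, d x x = 0) (hdpos : ∀ x y, x ≠ y → 0 < d x y)
    (hK : ∀ t : ℝ, 0 < t → SPD (fun x y => Real.exp (-t * d x y)))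
    (φ : ℝ → ℝ) (hφ : IsCMF φ) (hφ0 : φ 0 = 1)
    (hφtop : Filter.Tendsto φ Filter.atTop (nhds 0)) :
    SPD (fun x y => φ (d x y)) := by
  classical
  intro ι _ x hx
  rw [posDef_iff_sum]
  constructor
  · ext i j; simp [hsymm]
  intro c hc
  simp only [Matrix.of_apply]
  have hdnn : ∀ i j, 0 ≤ d (x i) (x j) := fun i j => by
    by_cases h : x i = x j
    · rw [h, hd0]
    · exact (hdpos _ _ h).le
  set F : ℝ → ℝ := fun t => ∑ i, ∑ j, c i * c j * Real.exp (-t * d (x i) (x j)) with hF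
  have hFpos : ∀ t, 0 < t → 0 < F t := fun t ht =>
    ((posDef_iff_sum _).mp (hK t ht ι x hx)).2 c hc
  have hF0 : 0 ≤ F 0 := by
    have : F 0 = (∑ i, c i) ^ 2 := by
      simp only [hF, neg_zero, zero_mul, Real.exp_zero, mul_one]
      rw [sq, Finset.sum_mul_sum]
    rw [this]; positivity
  have hFc : Continuous F := by simp only [hF]; fun_prop
  obtain ⟨i₀, hi₀⟩ := Function.ne_iff.mp hc
  have hSpos : 0 < ∑ i, c i * c i := by
    refine Finset.sum_pos' (fun i _ => mul_self_nonneg _) ⟨i₀, Finset.mem_univ _, ?_⟩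
    exact mul_self_pos.mpr hi₀
  have hFlim : Filter.Tendsto F Filter.atTop (nhds (∑ i, c i * c i)) := by
    have : ∑ i, c i * c i = ∑ i, ∑ j, c i * c j * (if i = j then 1 else 0) := by simp
    rw [this]
    refine tendsto_finsetSum _ fun i _ => tendsto_finsetSum _ fun j _ =>
      Filter.Tendsto.const_mul _ ?_
    by_cases hij : i = j
    · subst hij; simp [hd0]
    · simp only [hij, if_false]
      have hp := hdpos _ _ (fun h => hij (hx h))
      have h1 : Filter.Tendsto (fun t : ℝ => t * d (x i) (x j)) Filter.atTop Filter.atTop :=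
        Filter.tendsto_id.atTop_mul_const hp
      have := Real.tendsto_exp_neg_atTop_nhds_zero.comp h1
      simpa [Function.comp_def] using this
  -- choose X with φ X < 1/2
  obtain ⟨X, hX0, hX⟩ : ∃ X : ℝ, 0 < X ∧ φ X < 1 / 2 :=
    ((Filter.eventually_gt_atTop (0:ℝ)).and
      (hφtop.eventually (gt_mem_nhds (by norm_num : (0:ℝ) < 1/2)))).exists
  set τ := Real.log 2 / X with hτ
  have hτ0 : 0 < τ := div_pos (Real.log_pos (by norm_num)) hX0
  obtain ⟨δ, hδ, hFδ⟩ : ∃ δ > 0, ∀ t, τ ≤ t → δ ≤ F t := by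
    obtain ⟨T, hT⟩ := Filter.eventually_atTop.mp (hFlim.eventually (lt_mem_nhds (half_lt_self hSpos)))
    obtain ⟨t₀, ht₀, hmin⟩ := (isCompact_Icc (a := τ) (b := max τ T)).exists_isMinOn
      ⟨τ, by simp⟩ hFc.continuousOn
    refine ⟨min (F t₀) ((∑ i, c i * c i) / 2), lt_min (hFpos _ (hτ0.trans_le ht₀.1)) (by linarith), ?_⟩
    intro t ht
    rcases le_total t (max τ T) with h | h
    · exact (min_le_left _ _).trans (hmin ⟨ht, h⟩)
    · exact (min_le_right _ _).trans (hT t ((le_max_right _ _).trans h)).le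
  have key := laplace_pos (ι := (ι × ι) ⊕ Bool) hφ
    (Sum.elim (fun q => c q.1 * c q.2) (fun b => if b then 2 * δ else -δ))
    (Sum.elim (fun q => d (x q.1) (x q.2)) (fun b => if b then X else 0)) ?_ ?_
  · simp only [Fintype.sum_sum_type, Sum.elim_inl, Sum.elim_inr, Fintype.sum_prod_type,
      Fintype.sum_bool] at key
    simp [hφ0] at key
    nlinarith
  · rintro (q | b)
    · exact hdnn _ _
    · cases b <;> simp [hX0.le]
  · intro t ht
    simp only [Fintype.sum_sum_type, Sum.elim_inl, Sum.elim_inr, Fintype.sum_prod_type,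
      Fintype.sum_bool]
    have hFt : ∑ i, ∑ j, c i * c j * Real.exp (-t * d (x i) (x j)) = F t := rfl
    rw [hFt]
    simp only [if_true, Bool.false_eq_true, if_false, mul_zero, Real.exp_zero, mul_one]
    rcases le_total τ t with h | h
    · have := hFδ t h
      have := Real.exp_pos (-t * X)
      nlinarith
    · have h1 : 1 / 2 ≤ Real.exp (-t * X) := by
        rw [← Real.exp_log (show (0:ℝ) < 1 / 2 by norm_num)]
        apply Real.exp_le_exp.mpr
        rw [one_div, Real.log_inv]
        rw [hτ, le_div_iff₀ hX0] at h
        linarith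
      have h2 : 0 ≤ F t := by
        rcases ht.lt_or_eq with h | rfl
        · exact (hFpos t h).le
        · exact hF0
      nlinarith

lemma rpow_sign (r : ℝ) (hr : r ≤ 0) (k : ℕ) (x : ℝ) (hx : 0 < x) :
    0 ≤ (-1 : ℝ) ^ k * iteratedDeriv k (fun x : ℝ => x ^ r) x := by
  rw [iteratedDeriv_eq_iterate, Real.iter_deriv_rpow_const, ← mul_assoc]
  refine mul_nonneg ?_ (Real.rpow_nonneg hx.le _)
  induction k with
  | zero => simp
  | succ k ih =>
    rw [descPochhammer_succ_eval, pow_succ]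
    have : (r - k) ≤ 0 := by have := (Nat.cast_nonneg k : (0:ℝ) ≤ k); linarith
    nlinarith

lemma cmf_exp_rpow (t p : ℝ) (ht : 0 < t) (hp0 : 0 < p) (hp1 : p ≤ 1) :
    IsCMF (fun x => Real.exp (-t * x ^ p)) := by
  have hcd : ContDiffOn ℝ (⊤ : ℕ∞) (fun x => Real.exp (-t * x ^ p)) (Set.Ioi 0) := by
    intro x hx
    apply ContDiffAt.contDiffWithinAt
    exact (contDiffAt_const.mul (Real.contDiffAt_rpow_const_of_ne (ne_of_gt hx))).exp
  refine ⟨hcd, ?_, ?_⟩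
  · apply Continuous.continuousWithinAt
    have := Real.continuous_rpow_const hp0.le
    fun_prop
  · intro n
    induction n using Nat.strong_induction_on with
    | _ n ih =>
      intro x hx
      cases n with
      | zero => simp [(Real.exp_pos _).le]
      | succ n =>
        rw [iteratedDeriv_succ']
        have hev : deriv (fun x => Real.exp (-t * x ^ p)) =ᶠ[nhds x]
            fun x => (-(t * p)) * ((fun x => x ^ (p - 1)) x * (fun x => Real.exp (-t * x ^ p)) x) := by
          filter_upwards [Ioi_mem_nhds hx] with y hy
          have h1 := ((Real.hasDerivAt_rpow_const (x := y) (p := p) (Or.inl (ne_of_gt hy))).const_mul (-t)).exp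
          rw [h1.deriv]; ring
        have hc1 : ContDiffAt ℝ n (fun x : ℝ => x ^ (p - 1)) x :=
          Real.contDiffAt_rpow_const_of_ne (ne_of_gt hx)
        have hc2 : ContDiffAt ℝ n (fun x : ℝ => Real.exp (-t * x ^ p)) x :=
          (hcd.contDiffAt (Ioi_mem_nhds hx)).of_le (by exact_mod_cast le_top)
        rw [hev.iteratedDeriv_eq, iteratedDeriv_const_mul_field, iteratedDeriv_fun_mul hc1 hc2]
        have : (-1 : ℝ) ^ (n + 1) * (-(t * p) * ∑ i ∈ Finset.range (n + 1),
            (n.choose i : ℝ) * iteratedDeriv i (fun x : ℝ => x ^ (p - 1)) x *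
              iteratedDeriv (n - i) (fun x : ℝ => Real.exp (-t * x ^ p)) x) =
            (t * p) * ∑ i ∈ Finset.range (n + 1), (n.choose i : ℝ) *
              ((-1) ^ i * iteratedDeriv i (fun x : ℝ => x ^ (p - 1)) x) *
              ((-1) ^ (n - i) * iteratedDeriv (n - i) (fun x : ℝ => Real.exp (-t * x ^ p)) x) := by
          rw [pow_succ, show ∀ A B : ℝ, A * (-1) * (-(t * p) * B) = (t * p) * (A * B) by
            intros; ring, Finset.mul_sum]
          congr 1
          refine Finset.sum_congr rfl fun i hi => ?_
          have hi' : i ≤ n := by have := Finset.mem_range.mp hi; omega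
          have : (-1 : ℝ) ^ n = (-1) ^ i * (-1) ^ (n - i) := by rw [← pow_add]; congr 1; omega
          rw [this]; ring
        rw [this]
        refine mul_nonneg (by positivity) (Finset.sum_nonneg fun i _ => ?_)
        exact mul_nonneg (mul_nonneg (Nat.cast_nonneg _) (rpow_sign _ (by linarith) i x hx))
          (ih (n - i) (by omega) x hx)

lemma spd_exp_abs_rpow (t p : ℝ) (ht : 0 < t) (hp0 : 0 < p) (hp1 : p ≤ 1) :
    SPD (fun x y : ℝ => Real.exp (-t * |x - y| ^ p)) := by
  refine spd_of_cmf (fun x y : ℝ => |x - y|) (fun x y => abs_sub_comm x y) (by simp)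
    (fun x y h => abs_pos.mpr (sub_ne_zero.mpr h)) (fun s hs => spd_laplace s hs)
    (fun x => Real.exp (-t * x ^ p)) (cmf_exp_rpow t p ht hp0 hp1) ?_ ?_
  · simp [Real.zero_rpow hp0.ne']
  · have h1 : Filter.Tendsto (fun x : ℝ => t * x ^ p) Filter.atTop Filter.atTop :=
      (tendsto_rpow_atTop hp0).const_mul_atTop ht
    have := Real.tendsto_exp_neg_atTop_nhds_zero.comp h1
    simpa [Function.comp_def] using this

lemma spd_exp_pPowSum (t p : ℝ) (ht : 0 < t) (hp0 : 0 < p) (hp1 : p ≤ 1) (D : ℕ) :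
    SPD (fun x y : Fin D → ℝ => Real.exp (-t * pPowSum p (x - y))) := by
  induction D with
  | zero =>
    intro ι _ x hx
    have hs : Subsingleton ι := hx.subsingleton
    rw [posDef_iff_sum]
    constructor
    · ext i j; simp [pPowSum]
    · intro c hc
      obtain ⟨i₀, hi₀⟩ := Function.ne_iff.mp hc
      have hu : (Finset.univ : Finset ι) = {i₀} := by
        ext i; simp [Subsingleton.elim i i₀]
      rw [hu]
      simp only [Finset.sum_singleton, Matrix.of_apply]
      exact mul_pos (mul_self_pos.mpr hi₀) (Real.exp_pos _)
  | succ D ih =>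
    have h1 := ((spd_exp_abs_rpow t p ht hp0 hp1).prod ih).comp
      (fun x : Fin (D + 1) → ℝ => (x 0, Fin.tail x)) (by
        intro x y hxy
        simp only [Prod.mk.injEq] at hxy
        rw [← Fin.cons_self_tail x, ← Fin.cons_self_tail y, hxy.1, hxy.2])
    have h2 : (fun x y : Fin (D + 1) → ℝ => Real.exp (-t * pPowSum p (x - y))) =
        fun x y => Real.exp (-t * |x 0 - y 0| ^ p) *
          Real.exp (-t * pPowSum p (Fin.tail x - Fin.tail y)) := by
      funext x y
      rw [← Real.exp_add, ← mul_add]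
      simp only [pPowSum, Fin.sum_univ_succ, Pi.sub_apply, Fin.tail]
    rw [h2]
    exact h1

lemma spd_main {D : ℕ} (φ : ℝ → ℝ) (hφ : IsCMF φ) (hφ0 : φ 0 = 1)
    (hφtop : Filter.Tendsto φ Filter.atTop (nhds 0))
    (p : ℝ) (hp0 : 0 < p) (hp1 : p ≤ 1) :
    SPD (fun x y : Fin D → ℝ => φ (pPowSum p (x - y))) := by
  refine spd_of_cmf (fun x y : Fin D → ℝ => pPowSum p (x - y)) ?_ ?_ ?_
    (fun t ht => spd_exp_pPowSum t p ht hp0 hp1 D) φ hφ hφ0 hφtop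
  · intro x y; simp [pPowSum, abs_sub_comm]
  · intro x; simp [pPowSum, Real.zero_rpow hp0.ne']
  · intro x y hxy
    obtain ⟨i, hi⟩ := Function.ne_iff.mp hxy
    refine Finset.sum_pos' (fun d _ => Real.rpow_nonneg (abs_nonneg _) _) ⟨i, Finset.mem_univ _, ?_⟩
    exact Real.rpow_pos_of_pos (abs_pos.mpr (sub_ne_zero.mpr hi)) _

/-- `ω ↦ φ(‖ω‖_p^p)` is a positive definite function: for pairwise
distinct points and any nonzero complex vector `c`, the quantity `cᴴ G c` is a
positive real number. -/
theorem cmf_kernel_posDef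
    {D : ℕ} (hD : 1 ≤ D) (φ : ℝ → ℝ) (hφ : IsCMF φ) (hφ0 : φ 0 = 1)
    (hφtop : Filter.Tendsto φ Filter.atTop (nhds 0))
    (p : ℝ) (hp0 : 0 < p) (hp1 : p ≤ 1)
    (k : ℕ) (hk : 1 ≤ k) (θs : Fin k → (Fin D → ℝ)) (hinj : Function.Injective θs)
    (c : Fin k → ℂ) (hc : c ≠ 0) :
    0 < (∑ ℓ, ∑ ℓ', (starRingEnd ℂ) (c ℓ) *
          ((φ (pPowSum p (θs ℓ - θs ℓ')) : ℝ) : ℂ) * c ℓ').re ∧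
    (∑ ℓ, ∑ ℓ', (starRingEnd ℂ) (c ℓ) *
          ((φ (pPowSum p (θs ℓ - θs ℓ')) : ℝ) : ℂ) * c ℓ').im = 0 := by
  have hpd := (posDef_iff_sum _).mp (spd_main (D := D) φ hφ hφ0 hφtop p hp0 hp1 (Fin k) θs hinj)
  simp only [Matrix.of_apply] at hpd
  have hsymm : ∀ i j, φ (pPowSum p (θs i - θs j)) = φ (pPowSum p (θs j - θs i)) := by
    intro i j; simp [pPowSum, abs_sub_comm]
  have hQ := hpd.2
  have hQ0 : ∀ a : Fin k → ℝ, 0 ≤ ∑ i, ∑ j, a i * a j * φ (pPowSum p (θs i - θs j)) := by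
    intro a
    by_cases ha : a = 0
    · simp [ha]
    · exact (hQ a ha).le
  constructor
  · have hre : (∑ ℓ, ∑ ℓ', (starRingEnd ℂ) (c ℓ) *
          ((φ (pPowSum p (θs ℓ - θs ℓ')) : ℝ) : ℂ) * c ℓ').re =
        ∑ i, ∑ j, (c i).re * (c j).re * φ (pPowSum p (θs i - θs j)) +
        ∑ i, ∑ j, (c i).im * (c j).im * φ (pPowSum p (θs i - θs j)) := by
      rw [Complex.re_sum, ← Finset.sum_add_distrib]
      refine Finset.sum_congr rfl fun i _ => ?_
      rw [Complex.re_sum, ← Finset.sum_add_distrib]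
      refine Finset.sum_congr rfl fun j _ => ?_
      simp [Complex.mul_re, Complex.mul_im]
      ring
    rw [hre]
    by_cases h1 : (fun i => (c i).re) = 0
    · have h2 : (fun i => (c i).im) ≠ 0 := by
        intro h2
        apply hc
        funext i
        exact Complex.ext (congrFun h1 i) (congrFun h2 i)
      have := hQ _ h2
      have := hQ0 (fun i => (c i).re)
      linarith
    · have := hQ _ h1
      have := hQ0 (fun i => (c i).im)
      linarith
  · have him : (∑ ℓ, ∑ ℓ', (starRingEnd ℂ) (c ℓ) *
          ((φ (pPowSum p (θs ℓ - θs ℓ')) : ℝ) : ℂ) * c ℓ').im =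
        ∑ i, ∑ j, (c i).re * (c j).im * φ (pPowSum p (θs i - θs j)) -
        ∑ i, ∑ j, (c i).im * (c j).re * φ (pPowSum p (θs i - θs j)) := by
      rw [Complex.im_sum, ← Finset.sum_sub_distrib]
      refine Finset.sum_congr rfl fun i _ => ?_
      rw [Complex.im_sum, ← Finset.sum_sub_distrib]
      refine Finset.sum_congr rfl fun j _ => ?_
      simp [Complex.mul_re, Complex.mul_im]
      ring
    rw [him, sub_eq_zero, Finset.sum_comm]
    refine Finset.sum_congr rfl fun i _ => Finset.sum_congr rfl fun j _ => ?_
    rw [hsymm j i]; ring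
end

section
/- Let φ : [0,∞) → ℝ be a CMF with φ(0) = 1 and lim_{x→∞} φ(x) = 0, and let 0 < p ≤ 1. Let θ_1,…,θ_t, θ' ∈ ℝ be pairwise distinct and let c_1,…,c_t > 0 be positive reals with Σ_{ℓ=1}^t c_ℓ < 1. Define ψ : ℝ → ℝ by ψ(θ) = Σ_{ℓ=1}^t c_ℓ · φ(|θ − θ_ℓ|^p). If ψ(θ_j) ≤ φ(|θ_j − θ'|^p) for every j ∈ {1,…,t}, then ψ(θ) ≤ φ(|θ − θ'|^p) for every θ ∈ ℝ. -/
open Filter Topology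

def CMn : ℕ → (ℝ → ℝ) → Prop
  | 0, f => ∀ x, 0 < x → 0 ≤ f x
  | n+1, f => (∀ x, 0 < x → 0 ≤ f x) ∧ ∃ g : ℝ → ℝ, (∀ x, 0 < x → HasDerivAt f (-(g x)) x) ∧ CMn n g

theorem CMn.nonneg {n f} (h : CMn n f) : ∀ x, 0 < x → 0 ≤ f x := by
  cases n with
  | zero => exact h
  | succ n => exact h.1

theorem CMn.pred {n f} (h : CMn (n+1) f) : CMn n f := by
  induction n generalizing f with
  | zero => exact h.1
  | succ n ih =>
    obtain ⟨h0, g, hg, hn⟩ := h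
    exact ⟨h0, g, hg, ih hn⟩

theorem CMn.add {n f g} (hf : CMn n f) (hg : CMn n g) : CMn n (fun x => f x + g x) := by
  induction n generalizing f g with
  | zero => exact fun x hx => add_nonneg (hf x hx) (hg x hx)
  | succ n ih =>
    obtain ⟨h0, f', hf', hn⟩ := hf
    obtain ⟨h0', g', hg', hn'⟩ := hg
    refine ⟨fun x hx => add_nonneg (h0 x hx) (h0' x hx), fun x => f' x + g' x, fun x hx => ?_, ih hn hn'⟩
    exact ((hf' x hx).add (hg' x hx)).congr_deriv (by ring)

theorem CMn.mul {n f g} (hf : CMn n f) (hg : CMn n g) : CMn n (fun x => f x * g x) := by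
  induction n generalizing f g with
  | zero => exact fun x hx => mul_nonneg (hf x hx) (hg x hx)
  | succ n ih =>
    have hf1 := hf.pred
    have hg1 := hg.pred
    obtain ⟨h0, f', hf', hn⟩ := hf
    obtain ⟨h0', g', hg', hn'⟩ := hg
    refine ⟨fun x hx => mul_nonneg (h0 x hx) (h0' x hx), fun x => f' x * g x + f x * g' x,
      fun x hx => ?_, (ih hn hg1).add (ih hf1 hn')⟩
    exact ((hf' x hx).mul (hg' x hx)).congr_deriv (by ring)

theorem CMn.rpow (n : ℕ) (C q : ℝ) (hC : 0 ≤ C) (hq : q ≤ 0) : CMn n (fun x => C * x ^ q) := by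
  induction n generalizing C q with
  | zero => exact fun x hx => by positivity
  | succ n ih =>
    refine ⟨fun x hx => by positivity, fun x => (C * (-q)) * x ^ (q - 1), fun x hx => ?_,
      ih _ _ (mul_nonneg hC (by linarith)) (by linarith)⟩
    exact ((Real.hasDerivAt_rpow_const (p := q) (Or.inl hx.ne')).const_mul C).congr_deriv (by ring)

theorem CMn.comp {n φ} (hφ : CMn n φ) (p : ℝ) (hp0 : 0 < p) (hp1 : p ≤ 1) :
    CMn n (fun x => φ (x ^ p)) := by
  induction n generalizing φ with
  | zero => exact fun x hx => hφ _ (by positivity)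
  | succ n ih =>
    obtain ⟨h0, g, hg, hn⟩ := hφ
    refine ⟨fun x hx => h0 _ (by positivity), fun x => g (x ^ p) * (p * x ^ (p - 1)), fun x hx => ?_,
      (ih hn).mul (CMn.rpow n p (p-1) hp0.le (by linarith))⟩
    have := (hg (x ^ p) (by positivity)).comp x (Real.hasDerivAt_rpow_const (p := p) (Or.inl hx.ne'))
    exact this.congr_deriv (by ring)

theorem CMn.exists_seq {n f} (h : CMn n f) : ∃ g : ℕ → ℝ → ℝ, g 0 = f ∧
    (∀ k ≤ n, ∀ x, 0 < x → 0 ≤ g k x) ∧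
    (∀ k < n, ∀ x, 0 < x → HasDerivAt (g k) (-(g (k+1) x)) x) := by
  induction n generalizing f with
  | zero =>
    refine ⟨fun _ => f, rfl, fun k _ => h, fun k hk => by omega⟩
  | succ n ih =>
    obtain ⟨h0, g, hg, hn⟩ := h
    obtain ⟨G, hG0, hG1, hG2⟩ := ih hn
    refine ⟨fun k => Nat.casesOn k f G, rfl, ?_, ?_⟩
    · rintro (_ | k) hk
      · exact h0
      · exact hG1 k (by omega)
    · rintro (_ | k) hk
      · simpa [hG0] using hg
      · exact hG2 k (by omega)

theorem cmn_of_isCMF_aux {φ : ℝ → ℝ} (h1 : ContDiffOn ℝ (⊤ : ℕ∞) φ (Set.Ioi 0))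
    (h3 : ∀ (n : ℕ) (x : ℝ), 0 < x → 0 ≤ (-1 : ℝ) ^ n * iteratedDeriv n φ x) (n k : ℕ) :
    CMn n (fun x => (-1 : ℝ) ^ k * iteratedDeriv k φ x) := by
  induction n generalizing k with
  | zero => exact h3 k
  | succ n ih =>
    refine ⟨h3 k, _, fun x hx => ?_, ih (k+1)⟩
    have hd0 : DifferentiableAt ℝ (iteratedDerivWithin k φ (Set.Ioi 0)) x :=
      (h1.differentiableOn_iteratedDerivWithin (m := k) (by exact_mod_cast WithTop.coe_lt_top _)
        (uniqueDiffOn_Ioi 0)).differentiableAt (Ioi_mem_nhds hx)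
    have hd : DifferentiableAt ℝ (iteratedDeriv k φ) x := by
      refine hd0.congr_of_eventuallyEq ?_
      filter_upwards [Ioi_mem_nhds hx] with z hz
      exact (iteratedDerivWithin_of_isOpen isOpen_Ioi hz).symm
    have := hd.hasDerivAt.const_mul ((-1:ℝ)^k)
    exact this.congr_deriv (by rw [iteratedDeriv_succ]; ring)

/-- kernel approximation -/
theorem exp_approx (m : ℕ) (hm : 2 ≤ m) (s : ℝ) (hs : 0 ≤ s) :
    |(max (1 - s / m) 0) ^ m - Real.exp (-s)| ≤ 8 / m := by
  have hm0 : (0:ℝ) < m := by positivity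
  have hm2 : (2:ℝ) ≤ m := by exact_mod_cast hm
  have hem : Real.exp (-s) = Real.exp (-(s / m)) ^ m := by
    rw [← Real.exp_nat_mul]; congr 1; field_simp
  have hab : max (1 - s / m) 0 ≤ Real.exp (-(s/m)) := by
    apply max_le _ (Real.exp_pos _).le
    linarith [Real.add_one_le_exp (-(s/m))]
  have hle : (max (1 - s / m) 0) ^ m ≤ Real.exp (-s) := by
    rw [hem]; exact pow_le_pow_left₀ (le_max_right _ _) hab m
  rw [abs_sub_comm, abs_of_nonneg (by linarith)]
  rcases le_or_gt s m with h | h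
  · have h1 : 0 ≤ 1 - s / m := by rw [sub_nonneg, div_le_one hm0]; exact h
    rw [max_eq_left h1] at *
    set a := Real.exp (-(s/m)) with ha
    set b := 1 - s/m with hb
    have hgeo : a ^ m - b ^ m ≤ m * a^(m-1) * (a - b) := by
      rw [← Commute.mul_geom_sum₂ (Commute.all a b) m, mul_comm]
      apply mul_le_mul_of_nonneg_right _ (by linarith)
      calc ∑ i ∈ Finset.range m, a ^ i * b ^ (m - 1 - i) ≤ ∑ i ∈ Finset.range m, a ^ (m-1) := by
            apply Finset.sum_le_sum
            intro i hi
            have : i + (m - 1 - i) = m - 1 := by have := Finset.mem_range.1 hi; omega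
            calc a ^ i * b ^ (m - 1 - i) ≤ a^i * a^(m-1-i) := by gcongr
              _ = a^(m-1) := by rw [← pow_add, this]
        _ = _ := by simp
    have hsm : 0 ≤ s/m := by positivity
    have hdiff : a - b ≤ (s/m)^2 := by
      have h5 : s/m ≤ 1 := by rw [div_le_one hm0]; exact h
      have := Real.abs_exp_sub_one_sub_id_le (x := -(s/m)) (by rw [abs_neg, abs_of_nonneg hsm]; exact h5)
      have := (abs_le.1 this).2
      rw [hb]; nlinarith
    have ham : a^(m-1) = Real.exp (-(s * ((m-1)/m))) := by
      rw [ha, ← Real.exp_nat_mul, Nat.cast_sub (by omega)]; congr 1; push_cast; field_simp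
    have hu : s^2 * a^(m-1) ≤ 8 := by
      have h6 : a^(m-1) ≤ Real.exp (-(s/2)) := by
        rw [ham]
        apply Real.exp_le_exp.2
        have : (1:ℝ)/2 ≤ (m-1)/m := by rw [div_le_div_iff₀ (by norm_num) hm0]; linarith
        nlinarith
      have h7 := Real.quadratic_le_exp_of_nonneg (x := s/2) (by linarith)
      have h8 : s^2 ≤ 8 * Real.exp (s/2) := by nlinarith
      calc s^2 * a^(m-1) ≤ (8 * Real.exp (s/2)) * Real.exp (-(s/2)) := by gcongr
        _ = 8 := by rw [mul_assoc, ← Real.exp_add]; simp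
    rw [hem]
    calc a^m - b^m ≤ m * a^(m-1) * (a - b) := hgeo
      _ ≤ m * a^(m-1) * (s/m)^2 := by gcongr
      _ = s^2 * a^(m-1) / m := by field_simp
      _ ≤ 8 / m := by gcongr
  · have h0 : (0:ℝ) ≤ (max (1 - s / m) 0) ^ m := by positivity
    have : Real.exp (-s) ≤ 1 / m := by
      rw [Real.exp_neg, ← one_div]
      apply one_div_le_one_div_of_le hm0
      linarith [Real.add_one_le_exp s]
    have : (1:ℝ)/m ≤ 8/m := by gcongr; norm_num
    linarith

/-- Taylor polynomial of `g 0` at `t` evaluated at `y`, of degree `< n`. -/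
noncomputable def tayl (g : ℕ → ℝ → ℝ) (y : ℝ) (n : ℕ) (t : ℝ) : ℝ :=
  ∑ k ∈ Finset.range n, g k t * ((t - y) ^ k / (k.factorial : ℝ))

theorem tayl_deriv (g : ℕ → ℝ → ℝ) (y : ℝ) (m : ℕ) (t : ℝ)
    (hg : ∀ k < m + 1, HasDerivAt (g k) (-(g (k+1) t)) t) :
    HasDerivAt (tayl g y (m+1)) (-(g (m+1) t * ((t - y) ^ m / (m.factorial : ℝ)))) t := by
  induction m with
  | zero =>
    have := hg 0 (by norm_num)
    have e : tayl g y 1 = g 0 := by ext; simp [tayl]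
    rw [e]
    simpa using this
  | succ m ih =>
    have h1 := ih (fun k hk => hg k (by omega))
    have e : tayl g y (m+1+1) = fun t => tayl g y (m+1) t + g (m+1) t * ((t - y) ^ (m+1) / ((m+1).factorial : ℝ)) := by
      ext t; simp only [tayl]; rw [Finset.sum_range_succ _ (m+1)]
    rw [e]
    have h2 : HasDerivAt (fun t : ℝ => (t - y) ^ (m+1) / ((m+1).factorial : ℝ)) ((t-y)^m / (m.factorial : ℝ)) t := by
      have := ((((hasDerivAt_id t).sub_const y).pow (m+1))).div_const ((m+1).factorial : ℝ)
      refine this.congr_deriv ?_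
      simp [Nat.factorial_succ]
      field_simp
    refine (h1.add ((hg (m+1) (by omega)).mul h2)).congr_deriv ?_
    ring

theorem tayl_self (g : ℕ → ℝ → ℝ) (y : ℝ) (m : ℕ) : tayl g y (m+1) y = g 0 y := by
  simp [tayl, Finset.sum_range_succ']

/-- Frozen Taylor polynomial. -/
theorem tayl_max_deriv (g : ℕ → ℝ → ℝ) (y : ℝ) (m : ℕ) (hm : 1 ≤ m) (t : ℝ)
    (hg : ∀ k < m + 1, HasDerivAt (g k) (-(g (k+1) t)) t) :
    HasDerivAt (fun t => tayl g y (m+1) (max t y)) (-(g (m+1) t * ((max (t - y) 0) ^ m / (m.factorial : ℝ)))) t := by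
  rcases lt_trichotomy t y with h | h | h
  · rw [max_eq_right (by linarith), zero_pow (by omega)]
    simp only [zero_div, mul_zero, neg_zero]
    refine (hasDerivAt_const t (tayl g y (m+1) y)).congr_of_eventuallyEq ?_
    filter_upwards [Iio_mem_nhds h] with s hs
    rw [max_eq_right (le_of_lt hs)]
  · subst h
    have h1 := tayl_deriv g t m t hg
    simp only [sub_self, max_self]  at *
    rw [← hasDerivWithinAt_univ, ← Set.Iic_union_Ici (a := t)]
    refine HasDerivWithinAt.union ?_ ?_
    · rw [zero_pow (by omega)]
      simp only [zero_div, mul_zero, neg_zero]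
      refine (hasDerivWithinAt_const t _ (tayl g t (m+1) t)).congr ?_ ?_
      · intro s hs; rw [max_eq_right hs]
      · simp
    · refine h1.hasDerivWithinAt.congr ?_ ?_
      · intro s hs; rw [max_eq_left hs]
      · simp
  · rw [max_eq_left (by linarith)]
    refine (tayl_deriv g y m t hg).congr_of_eventuallyEq ?_
    filter_upwards [Ioi_mem_nhds h] with s hs
    rw [max_eq_left (le_of_lt hs)]

theorem decay (g : ℕ → ℝ → ℝ) (n : ℕ) (h0 : ∀ k ≤ n, ∀ x, 0 ≤ x → 0 ≤ g k x)
    (hd : ∀ k < n, ∀ x, 0 ≤ x → HasDerivAt (g k) (-(g (k+1) x)) x)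
    (hlim : Tendsto (g 0) atTop (𝓝 0)) (k : ℕ) (hk : k < n) :
    Tendsto (fun x => x ^ k * g k x) atTop (𝓝 0) := by
  induction k with
  | zero => simpa using hlim
  | succ k ih =>
    have ih := ih (by omega)
    have hhalf : Tendsto (fun x : ℝ => x / 2) atTop atTop := tendsto_id.atTop_div_const (by norm_num)
    have h2 := (ih.comp hhalf).const_mul (2 ^ (k+1) : ℝ)
    rw [mul_zero] at h2
    refine squeeze_zero' ?_ ?_ h2
    · filter_upwards [eventually_gt_atTop 0] with x hx
      exact mul_nonneg (by positivity) (h0 _ (by omega) x hx.le)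
    · filter_upwards [eventually_gt_atTop 0] with x hx
      have anti : AntitoneOn (g (k+1)) (Set.Ici 0) := by
        refine antitoneOn_of_hasDerivWithinAt_nonpos (convex_Ici 0) (f' := fun x => -(g (k+2) x)) ?_ ?_ ?_
        · intro z hz; exact (hd (k+1) hk z hz).continuousAt.continuousWithinAt
        · intro z hz
          rw [interior_Ici] at hz
          exact (hd (k+1) hk z (le_of_lt hz)).hasDerivWithinAt
        · intro z hz
          rw [interior_Ici] at hz
          have := h0 (k+2) (by omega) z (le_of_lt hz)
          linarith
      obtain ⟨z, hz, he⟩ := exists_hasDerivAt_eq_slope (g k) (fun x => -(g (k+1) x)) (a := x/2) (b := x)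
        (by linarith) (fun z hz => (hd k (by omega) z (by linarith [hz.1])).continuousAt.continuousWithinAt)
        (fun z hz => hd k (by omega) z (by linarith [hz.1]))
      have h3 : g (k+1) x ≤ g (k+1) z := anti (Set.mem_Ici.2 (by linarith [hz.1])) (Set.mem_Ici.2 hx.le) hz.2.le
      have h4 := h0 k (by omega) x hx.le
      have h5 : g (k+1) z * (x/2) = g k (x/2) - g k x := by
        have : x - x/2 ≠ 0 := by linarith
        rw [eq_div_iff this] at he
        linarith
      have h6 : g (k+1) x * (x/2) ≤ g k (x/2) := by nlinarith
      calc x^(k+1) * g (k+1) x = 2 ^ (k+1) * ((x/2)^k * (g (k+1) x * (x/2))) := by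
            rw [div_pow, pow_succ, pow_succ]; field_simp
        _ ≤ 2 ^ (k+1) * ((x/2)^k * g k (x/2)) := by gcongr

theorem tayl_lim (g : ℕ → ℝ → ℝ) (n : ℕ) (h0 : ∀ k ≤ n, ∀ x, 0 ≤ x → 0 ≤ g k x)
    (hd : ∀ k < n, ∀ x, 0 ≤ x → HasDerivAt (g k) (-(g (k+1) x)) x)
    (hlim : Tendsto (g 0) atTop (𝓝 0)) (y : ℝ) (hy : 0 ≤ y) :
    Tendsto (fun t => tayl g y n (max t y)) atTop (𝓝 0) := by
  have : Tendsto (tayl g y n) atTop (𝓝 0) := by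
    unfold tayl
    rw [show (0:ℝ) = ∑ k ∈ Finset.range n, 0 by simp]
    refine tendsto_finsetSum _ fun k hk => ?_
    have hk := Finset.mem_range.1 hk
    refine squeeze_zero' ?_ ?_ (decay g n h0 hd hlim k hk)
    · filter_upwards [eventually_ge_atTop y] with x hx
      have := h0 k hk.le x (by linarith)
      have : 0 ≤ x - y := by linarith
      positivity
    · filter_upwards [eventually_ge_atTop y] with x hx
      have := h0 k hk.le x (by linarith)
      have h1 : 0 ≤ x - y := by linarith
      rw [mul_comm]
      gcongr
      calc (x-y)^k / (k.factorial:ℝ) ≤ (x-y)^k := div_le_self (by positivity) (by exact_mod_cast k.factorial_pos)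
        _ ≤ x^k := by gcongr; linarith
  refine this.congr' ?_
  filter_upwards [eventually_ge_atTop y] with x hx
  rw [max_eq_left hx]

theorem dual_n {ι : Type} [Fintype ι] (w y : ι → ℝ) (hy : ∀ i, 0 ≤ y i)
    (hpos : ∀ l : ℝ, 0 ≤ l → 0 ≤ ∑ i, w i * Real.exp (-(l * y i)))
    (m : ℕ) (hm : 2 ≤ m) (g : ℕ → ℝ → ℝ) (h0 : ∀ k ≤ m + 1, ∀ x, 0 ≤ x → 0 ≤ g k x)
    (hd : ∀ k < m + 1, ∀ x, 0 ≤ x → HasDerivAt (g k) (-(g (k+1) x)) x)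
    (hlim : Tendsto (g 0) atTop (𝓝 0)) :
    0 ≤ ∑ i, w i * g 0 (y i) + (∑ i, |w i|) * (8 / m) * g 0 0 := by
  set ε := (∑ i, |w i|) * (8 / (m:ℝ)) with hε
  have hm0 : (0:ℝ) < m := by positivity
  let Φ : ℝ → ℝ := fun t => ∑ i, w i * tayl g (y i) (m+1) (max t (y i)) + ε * tayl g 0 (m+1) (max t 0)
  have hΦ : ∀ t, 0 ≤ t → HasDerivAt Φ (∑ i, w i * (-(g (m+1) t * ((max (t - y i) 0) ^ m / (m.factorial : ℝ))))
      + ε * (-(g (m+1) t * ((max (t - 0) 0) ^ m / (m.factorial : ℝ))))) t := by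
    intro t ht
    refine HasDerivAt.add (HasDerivAt.fun_sum fun i _ => ?_) ?_
    · exact (tayl_max_deriv g (y i) m (by omega) t (fun k hk => hd k hk t ht)).const_mul _
    · exact (tayl_max_deriv g 0 m (by omega) t (fun k hk => hd k hk t ht)).const_mul _
  have hanti : AntitoneOn Φ (Set.Ici 0) := by
    refine antitoneOn_of_hasDerivWithinAt_nonpos (convex_Ici 0) (f' := fun t => ∑ i, w i * (-(g (m+1) t * ((max (t - y i) 0) ^ m / (m.factorial : ℝ))))
      + ε * (-(g (m+1) t * ((max (t - 0) 0) ^ m / (m.factorial : ℝ))))) ?_ ?_ ?_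
    · intro z hz; exact (hΦ z hz).continuousAt.continuousWithinAt
    · intro z hz
      rw [interior_Ici] at hz
      exact (hΦ z (le_of_lt hz)).hasDerivWithinAt
    · intro t ht
      rw [interior_Ici] at ht
      have ht : 0 < t := ht
      have e : ∀ y : ℝ, (max (t - y) 0) ^ m = t ^ m * (max (1 - (m * (y / t)) / m) 0) ^ m := by
        intro y
        rw [← mul_pow, mul_max_of_nonneg _ _ ht.le]
        congr 2
        · field_simp
        · simp
      have key : 0 ≤ ∑ i, w i * (max (1 - (m * (y i / t)) / m) 0) ^ m + ε := by
        have h1 := hpos (m / t) (by positivity)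
        have h2 : ∑ i, w i * Real.exp (-(m / t * y i)) ≤ ∑ i, (w i * (max (1 - (m * (y i / t)) / m) 0) ^ m + |w i| * (8 / m)) := by
          refine Finset.sum_le_sum fun i _ => ?_
          have h3 := exp_approx m hm (m * (y i / t)) (mul_nonneg hm0.le (div_nonneg (hy i) ht.le))
          have h4 : (m:ℝ) / t * y i = m * (y i / t) := by ring
          rw [h4]
          set A := (max (1 - (m * (y i / t)) / m) 0) ^ m
          set B := Real.exp (-(m * (y i / t)))
          have h5 : w i * (B - A) ≤ |w i| * |A - B| := by
            rw [abs_sub_comm, ← abs_mul]; exact le_abs_self _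
          have h6 : |w i| * |A - B| ≤ |w i| * (8 / m) := by gcongr
          linarith
        rw [Finset.sum_add_distrib, ← Finset.sum_mul] at h2
        linarith
      have h7 := h0 (m+1) le_rfl t ht.le
      have : ∑ i, w i * (-(g (m+1) t * ((max (t - y i) 0) ^ m / (m.factorial : ℝ))))
        + ε * (-(g (m+1) t * ((max (t - 0) 0) ^ m / (m.factorial : ℝ)))) =
        -((g (m+1) t * t ^ m / (m.factorial : ℝ)) * (∑ i, w i * (max (1 - (m * (y i / t)) / m) 0) ^ m + ε)) := by
        simp only [e, mul_add, Finset.mul_sum, neg_add, ← Finset.sum_neg_distrib]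
        congr 1
        · refine Finset.sum_congr rfl fun i _ => ?_
          ring
        · simp
          ring
      rw [this]
      have : 0 ≤ g (m+1) t * t ^ m / (m.factorial : ℝ) := by positivity
      have := mul_nonneg this key
      linarith
  have hlimΦ : Tendsto Φ atTop (𝓝 0) := by
    have : (0:ℝ) = ∑ i : ι, w i * 0 + ε * 0 := by simp
    rw [this]
    refine Tendsto.add (tendsto_finsetSum _ fun i _ => ?_) ?_
    · exact (tayl_lim g (m+1) h0 hd hlim (y i) (hy i)).const_mul _
    · exact (tayl_lim g (m+1) h0 hd hlim 0 le_rfl).const_mul _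
  have hfin : 0 ≤ Φ 0 := by
    refine le_of_tendsto hlimΦ ?_
    filter_upwards [eventually_ge_atTop 0] with t ht
    exact hanti (Set.mem_Ici.2 le_rfl) (Set.mem_Ici.2 ht) ht
  have : Φ 0 = ∑ i, w i * g 0 (y i) + ε * g 0 0 := by
    simp only [Φ]
    congr 1
    · refine Finset.sum_congr rfl fun i _ => ?_
      rw [max_eq_right (hy i), tayl_self]
    · rw [max_self, tayl_self]
  linarith

/-- `K` lies in the closed cone generated by the kernels `exp (-l |x|)`. -/
def DualPos (K : ℝ → ℝ) : Prop := ∀ (ι : Type) [Fintype ι] (w y : ι → ℝ),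
  (∀ l : ℝ, 0 ≤ l → 0 ≤ ∑ i, w i * Real.exp (-(l * |y i|))) → 0 ≤ ∑ i, w i * K (y i)

theorem dual_cm (F : ℝ → ℝ) (hF : ∀ n, CMn n F) (hlim : Tendsto F atTop (𝓝 0))
    (hc : ContinuousOn F (Set.Ici 0))
    {ι : Type} [Fintype ι] (w y : ι → ℝ) (hy : ∀ i, 0 ≤ y i)
    (hpos : ∀ l : ℝ, 0 ≤ l → 0 ≤ ∑ i, w i * Real.exp (-(l * y i))) :
    0 ≤ ∑ i, w i * F (y i) := by
  have step : ∀ δ : ℝ, 0 < δ → 0 ≤ ∑ i, w i * F (y i + δ) := by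
    intro δ hδ
    have hn : ∀ m : ℕ, 2 ≤ m → 0 ≤ ∑ i, w i * F (y i + δ) + (∑ i, |w i|) * (8 / m) * F δ := by
      intro m hm
      obtain ⟨g, hg0, hg1, hg2⟩ := (hF (m+1)).exists_seq
      have := dual_n w y hy hpos m hm (fun k x => g k (x + δ))
        (fun k hk x hx => hg1 k hk _ (by linarith))
        (fun k hk x hx => (hg2 k hk (x + δ) (by linarith)).comp_add_const x δ)
        (by rw [hg0]; exact hlim.comp (tendsto_atTop_add_const_right _ _ tendsto_id))
      simpa [hg0] using this
    have hl : Tendsto (fun m : ℕ => ∑ i, w i * F (y i + δ) + (∑ i, |w i|) * (8 / (m:ℝ)) * F δ) atTop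
        (𝓝 (∑ i, w i * F (y i + δ) + (∑ i, |w i|) * 0 * F δ)) :=
      (((tendsto_const_div_atTop_nhds_zero_nat 8).const_mul _).mul_const _).const_add _
    have := ge_of_tendsto hl (by
      filter_upwards [eventually_ge_atTop 2] with m hm
      exact hn m hm)
    simpa using this
  have hl : Tendsto (fun δ : ℝ => ∑ i, w i * F (y i + δ)) (𝓝[>] 0) (𝓝 (∑ i, w i * F (y i))) := by
    refine tendsto_finsetSum _ fun i _ => Tendsto.const_mul _ ?_
    refine (hc (y i) (hy i)).tendsto.comp (tendsto_nhdsWithin_iff.2 ⟨?_, ?_⟩)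
    · have : Tendsto (fun δ : ℝ => y i + δ) (𝓝 0) (𝓝 (y i + 0)) := (continuous_const.add continuous_id).tendsto 0
      rw [add_zero] at this
      exact this.mono_left nhdsWithin_le_nhds
    · filter_upwards [self_mem_nhdsWithin] with δ hδ
      have : (0:ℝ) < δ := hδ
      exact Set.mem_Ici.2 (by linarith [hy i])
  refine ge_of_tendsto hl ?_
  filter_upwards [self_mem_nhdsWithin] with δ hδ
  exact step δ hδ

theorem dualPos_of_cm (φ : ℝ → ℝ) (hφ : ∀ n, CMn n φ) (h2 : ContinuousWithinAt φ (Set.Ici 0) 0)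
    (hlim : Tendsto φ atTop (𝓝 0)) (p : ℝ) (hp0 : 0 < p) (hp1 : p ≤ 1) :
    DualPos (fun x => φ (|x| ^ p)) := by
  intro ι _ w y hpos
  have hcφ : ContinuousOn φ (Set.Ici 0) := by
    intro x hx
    rcases eq_or_lt_of_le (Set.mem_Ici.1 hx) with h | h
    · rw [← h]; exact h2
    · obtain ⟨-, g, hg, -⟩ := hφ 1
      exact (hg x h).continuousAt.continuousWithinAt
  refine dual_cm (fun x => φ (x ^ p)) (fun n => (hφ n).comp p hp0 hp1) ?_ ?_ w (fun i => |y i|)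
    (fun i => abs_nonneg _) hpos
  · exact hlim.comp (tendsto_rpow_atTop hp0)
  · refine hcφ.comp (Real.continuous_rpow_const hp0.le).continuousOn ?_
    intro x hx
    exact Real.rpow_nonneg hx p

theorem dual_zero (K : ℝ → ℝ) (hK : DualPos K) (hK0 : K 0 = 1) {t : ℕ} (a c : Fin t → ℝ)
    (hc : ∀ l, 0 < c l) (hsum : ∑ l, c l < 1) : ∑ l, c l * K (a l) ≤ 1 := by
  have h1 : ∀ x, K x ≤ 1 := by
    intro x
    have := hK (Fin 2) ![1, -1] ![0, x] (by
      intro l hl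
      have : Real.exp (-(l * |x|)) ≤ 1 := Real.exp_le_one_iff.2 (by nlinarith [abs_nonneg x])
      simp [Fin.sum_univ_two] at this ⊢
      linarith)
    simp [Fin.sum_univ_two, hK0] at this
    linarith
  calc ∑ l, c l * K (a l) ≤ ∑ l, c l * 1 := by
        refine Finset.sum_le_sum fun l _ => ?_
        exact mul_le_mul_of_nonneg_left (h1 _) (hc l).le
    _ ≤ 1 := by simpa using hsum.le

/-- Transfer of three-point inequalities from exponentials to `K`. -/
theorem transfer (K : ℝ → ℝ) (hK : DualPos K) {t : ℕ} (a c : Fin t → ℝ) (x z b u v : ℝ)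
    (h : ∀ l : ℝ, 0 ≤ l →
      (∑ j, c j * Real.exp (-(l * |x - a j|)) - Real.exp (-(l * |x|))) ≤
      u * (∑ j, c j * Real.exp (-(l * |z - a j|)) - Real.exp (-(l * |z|))) +
      v * (∑ j, c j * Real.exp (-(l * |b - a j|)) - Real.exp (-(l * |b|)))) :
    (∑ j, c j * K (x - a j) - K x) ≤
      u * (∑ j, c j * K (z - a j) - K z) + v * (∑ j, c j * K (b - a j) - K b) := by
  have := hK (Fin 3 × Option (Fin t))
    (fun q => (![-1, u, v] q.1) * (q.2.elim (-1) c))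
    (fun q => (![x, z, b] q.1) - (q.2.elim 0 a)) (by
      intro l hl
      have := h l hl
      simp [Fintype.sum_prod_type, Fintype.sum_option, Fin.sum_univ_three, mul_assoc, ← Finset.mul_sum]
      linarith)
  simp [Fintype.sum_prod_type, Fintype.sum_option, Fin.sum_univ_three, mul_assoc, ← Finset.mul_sum] at this
  linarith

theorem convex_inside {f : ℝ → ℝ} (hf : ConvexOn ℝ Set.univ f) {M x y z : ℝ} (hxy : x ≤ y) (hyz : y ≤ z)
    (hx : f x ≤ M) (hz : f z ≤ M) : f y ≤ M := by
  have := hf.le_max_of_mem_Icc (Set.mem_univ x) (Set.mem_univ z) ⟨hxy, hyz⟩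
  exact this.trans (max_le hx hz)

theorem convex_outside {f : ℝ → ℝ} (hf : ConvexOn ℝ Set.univ f) {M x y z : ℝ} (hxy : x < y) (hyz : y ≤ z)
    (hx : f x ≤ M) (hy : M ≤ f y) : M ≤ f z := by
  rcases eq_or_lt_of_le hyz with h | h
  · rw [← h]; exact hy
  by_contra! hz
  have h1 := hf.slope_mono_adjacent (Set.mem_univ x) (Set.mem_univ z) hxy h
  have h2 : 0 ≤ (f y - f x) / (y - x) := div_nonneg (by linarith) (by linarith)
  have h3 : (f z - f y) / (z - y) < 0 := div_neg_of_neg_of_pos (by linarith) (by linarith)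
  linarith

theorem convex_outside_left {f : ℝ → ℝ} (hf : ConvexOn ℝ Set.univ f) {M x y z : ℝ} (hxy : x ≤ y) (hyz : y < z)
    (hy : M ≤ f y) (hz : f z ≤ M) : M ≤ f x := by
  rcases eq_or_lt_of_le hxy with h | h
  · rw [h]; exact hy
  by_contra! hx
  have h1 := hf.slope_mono_adjacent (Set.mem_univ x) (Set.mem_univ z) h hyz
  have h2 : (f z - f y) / (z - y) ≤ 0 := div_nonpos_of_nonpos_of_nonneg (by linarith) (by linarith)
  have h3 : 0 < (f y - f x) / (y - x) := div_pos (by linarith) (by linarith)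
  linarith

theorem convex_exp (r : ℝ) : ConvexOn ℝ Set.univ (fun l : ℝ => Real.exp (l * r)) := by
  have := convexOn_exp.comp_linearMap (LinearMap.lsmul ℝ ℝ r)
  refine this.congr ?_
  intro l _
  simp [mul_comm]

theorem convex_expsum {ι : Type} (s : Finset ι) (c a : ι → ℝ) (hc : ∀ i, 0 ≤ c i) :
    ConvexOn ℝ Set.univ (fun l : ℝ => ∑ i ∈ s, c i * Real.exp (l * a i)) := by
  classical
  induction s using Finset.induction_on with
  | empty => simpa using convexOn_const (0:ℝ) convex_univ
  | insert i s hi ih =>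
    simp only [Finset.sum_insert hi]
    exact ((convex_exp (a i)).smul (hc i)).add ih

theorem core (K : ℝ → ℝ) (hK : DualPos K) (hK0 : K 0 = 1) {t : ℕ} (a c : Fin t → ℝ)
    (hc : ∀ l, 0 < c l) (hsum : ∑ l, c l < 1)
    (hdom : ∀ j, ∑ l, c l * K (a j - a l) ≤ K (a j)) (x : ℝ) (hx : 0 < x) :
    ∑ l, c l * K (x - a l) ≤ K x := by
  classical
  by_cases hxa : ∃ j, a j = x
  · obtain ⟨j, rfl⟩ := hxa
    exact hdom j
  push Not at hxa
  set L := Finset.univ.filter (fun j => a j < x) with hL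
  set R := Finset.univ.filter (fun j => ¬ a j < x) with hR
  -- left node
  obtain ⟨z, hz0, hzx, hzL, hDz⟩ : ∃ z, 0 ≤ z ∧ z < x ∧ (∀ j ∈ L, a j ≤ z) ∧
      (∑ l, c l * K (z - a l) - K z ≤ 0) := by
    have hne : (insert 0 (L.image a)).Nonempty := ⟨0, by simp⟩
    have hmem := Finset.max'_mem _ hne
    have hle := Finset.le_max' (insert 0 (L.image a))
    set z := (insert 0 (L.image a)).max' hne
    refine ⟨z, hle 0 (by simp), ?_, fun j hj => hle _ (by simp; right; exact ⟨j, hj, rfl⟩), ?_⟩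
    · rcases Finset.mem_insert.1 hmem with h | h
      · rw [h]; exact hx
      · obtain ⟨j, hj, hj2⟩ := Finset.mem_image.1 h
        rw [← hj2]; exact (Finset.mem_filter.1 hj).2
    · rcases Finset.mem_insert.1 hmem with h | h
      · rw [h, hK0]
        have := dual_zero K hK hK0 (fun l => 0 - a l) c hc hsum
        linarith
      · obtain ⟨j, hj, hj2⟩ := Finset.mem_image.1 h
        rw [← hj2]; linarith [hdom j]
  -- exponentials on the interval
  set h : ℝ → ℝ := fun l => ∑ j ∈ L, c j * Real.exp (l * a j) with hh
  set B : ℝ → ℝ := fun l => ∑ j ∈ R, c j * Real.exp (-(l * a j)) with hB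
  have hBnn : ∀ l, 0 ≤ B l := fun l => Finset.sum_nonneg fun j _ => mul_nonneg (hc j).le (Real.exp_pos _).le
  have hE : ∀ y, 0 ≤ y → (∀ j ∈ L, a j ≤ y) → (∀ j ∈ R, y ≤ a j) → ∀ l,
      (∑ j, c j * Real.exp (-(l * |y - a j|)) - Real.exp (-(l * |y|))) =
      Real.exp (-(l * y)) * (h l - 1) + Real.exp (l * y) * B l := by
    intro y hy hyL hyR l
    rw [← Finset.sum_filter_add_sum_filter_not Finset.univ (fun j => a j < x), ← hL, ← hR,
      abs_of_nonneg hy]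
    have e1 : ∑ j ∈ L, c j * Real.exp (-(l * |y - a j|)) = Real.exp (-(l * y)) * h l := by
      rw [hh, Finset.mul_sum]
      refine Finset.sum_congr rfl fun j hj => ?_
      rw [abs_of_nonneg (by linarith [hyL j hj]), show -(l * (y - a j)) = -(l*y) + l * a j by ring, Real.exp_add]
      ring
    have e2 : ∑ j ∈ R, c j * Real.exp (-(l * |y - a j|)) = Real.exp (l * y) * B l := by
      rw [hB, Finset.mul_sum]
      refine Finset.sum_congr rfl fun j hj => ?_
      rw [abs_of_nonpos (by linarith [hyR j hj]), show -(l * -(y - a j)) = l*y + -(l * a j) by ring, Real.exp_add]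
      ring
    rw [e1, e2]; ring
  have hLx : ∀ j ∈ L, a j ≤ x := fun j hj => (Finset.mem_filter.1 hj).2.le
  have hRx : ∀ j ∈ R, x ≤ a j := fun j hj => not_lt.1 (Finset.mem_filter.1 hj).2
  have hEx := hE x hx.le hLx hRx
  have hEz := hE z hz0 hzL (fun j hj => hzx.le.trans (hRx j hj))
  have hconv : ConvexOn ℝ Set.univ h := convex_expsum L c a (fun i => (hc i).le)
  have hh0 : h 0 < 1 := by
    simp only [hh, zero_mul, Real.exp_zero, mul_one]
    refine lt_of_le_of_lt ?_ hsum
    exact Finset.sum_le_sum_of_subset_of_nonneg (Finset.subset_univ _) (fun j _ _ => (hc j).le)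
  have hcont : Continuous h := by fun_prop
  -- sign change
  have hsign : (∀ l, 0 ≤ l → h l ≤ 1) ∨ ∃ l0, 0 < l0 ∧ (∀ l, 0 ≤ l → l ≤ l0 → h l ≤ 1) ∧ (∀ l, l0 ≤ l → 1 ≤ h l) := by
    by_cases hc1 : ∀ l, 0 ≤ l → h l ≤ 1
    · exact Or.inl hc1
    push Not at hc1
    obtain ⟨l1, hl1, hl1'⟩ := hc1
    obtain ⟨l0, hl0, hl0'⟩ := intermediate_value_Icc hl1 hcont.continuousOn ⟨hh0.le, hl1'.le⟩
    have hpos : 0 < l0 := by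
      rcases eq_or_lt_of_le hl0.1 with e | e
      · rw [← e] at hl0'; linarith
      · exact e
    exact Or.inr ⟨l0, hpos, fun l h1 h2 => convex_inside hconv h1 h2 hh0.le hl0'.le,
      fun l hl => convex_outside hconv hpos hl hh0.le hl0'.ge⟩
  -- it suffices to find u, v
  suffices hs : ∃ b u v : ℝ, 0 ≤ u ∧ 0 ≤ v ∧ (v = 0 ∨ ∑ l, c l * K (b - a l) - K b ≤ 0) ∧
      ∀ l : ℝ, 0 ≤ l →
      (∑ j, c j * Real.exp (-(l * |x - a j|)) - Real.exp (-(l * |x|))) ≤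
      u * (∑ j, c j * Real.exp (-(l * |z - a j|)) - Real.exp (-(l * |z|))) +
      v * (∑ j, c j * Real.exp (-(l * |b - a j|)) - Real.exp (-(l * |b|))) by
    obtain ⟨b, u, v, hu, hv, hb, hl⟩ := hs
    have h1 := transfer K hK a c x z b u v hl
    have h2 := mul_nonpos_of_nonneg_of_nonpos hu hDz
    have h3 : v * (∑ l, c l * K (b - a l) - K b) ≤ 0 := by
      rcases hb with hb | hb
      · rw [hb, zero_mul]
      · exact mul_nonpos_of_nonneg_of_nonpos hv hb
    linarith
  rcases R.eq_empty_or_nonempty with hRe | hRne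
  · have hB0 : ∀ l, B l = 0 := fun l => by simp [hB, hRe]
    rcases hsign with h1 | ⟨l0, hl0, hin, hout⟩
    · refine ⟨0, 0, 0, le_rfl, le_rfl, Or.inl rfl, fun l hl => ?_⟩
      rw [hEx, hB0]
      have := mul_nonpos_of_nonneg_of_nonpos (Real.exp_pos (-(l * x))).le (sub_nonpos.2 (h1 l hl))
      linarith
    · refine ⟨0, Real.exp (-(l0 * (x - z))), 0, (Real.exp_pos _).le, le_rfl, Or.inl rfl, fun l hl => ?_⟩
      rw [hEx, hEz, hB0]
      have e : Real.exp (-(l * x)) = Real.exp (-(l * z)) * Real.exp (-(l * (x - z))) := by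
        rw [← Real.exp_add]; congr 1; ring
      rw [e]
      have h3 : (Real.exp (-(l * (x - z))) - Real.exp (-(l0 * (x - z)))) * (h l - 1) ≤ 0 := by
        rcases le_total l l0 with hll | hll
        · refine mul_nonpos_of_nonneg_of_nonpos (sub_nonneg.2 (Real.exp_le_exp.2 ?_)) (sub_nonpos.2 (hin l hl hll))
          nlinarith
        · refine mul_nonpos_of_nonpos_of_nonneg (sub_nonpos.2 (Real.exp_le_exp.2 ?_)) (sub_nonneg.2 (hout l hll))
          nlinarith
      have := mul_nonpos_of_nonneg_of_nonpos (Real.exp_pos (-(l * z))).le h3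
      linarith
  · obtain ⟨jb, hjb, hjmin⟩ := R.exists_min_image a hRne
    set b := a jb with hb
    have hxb : x < b := lt_of_le_of_ne (hRx jb hjb) (fun e => hxa jb e.symm)
    have hEb := hE b (by linarith) (fun j hj => (hLx j hj).trans hxb.le) hjmin
    have hDb : ∑ l, c l * K (b - a l) - K b ≤ 0 := by linarith [hdom jb]
    rcases hsign with h1 | ⟨l0, hl0, hin, hout⟩
    · refine ⟨b, 0, 1, le_rfl, zero_le_one, Or.inr hDb, fun l hl => ?_⟩
      rw [hEx, hEb]
      have e1 : Real.exp (-(l * b)) ≤ Real.exp (-(l * x)) := Real.exp_le_exp.2 (by nlinarith)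
      have e2 : Real.exp (l * x) ≤ Real.exp (l * b) := Real.exp_le_exp.2 (by nlinarith)
      have := mul_le_mul_of_nonneg_right e2 (hBnn l)
      have := mul_le_mul_of_nonpos_right e1 (sub_nonpos.2 (h1 l hl))
      linarith
    · set P := Real.exp (l0 * (x - z)) with hP
      set Q := Real.exp (l0 * (x - b)) with hQ
      have hP1 : 1 < P := Real.one_lt_exp_iff.2 (mul_pos hl0 (by linarith))
      have hQ1 : Q < 1 := Real.exp_lt_one_iff.2 (by nlinarith)
      have hPQ : 0 < P - Q := by linarith
      set u := (1 - Q) / (P - Q) with hu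
      set v := (P - 1) / (P - Q) with hv
      have hu0 : 0 ≤ u := div_nonneg (by linarith) hPQ.le
      have hv0 : 0 ≤ v := div_nonneg (by linarith) hPQ.le
      set q : ℝ → ℝ := fun l => u * Real.exp (l * (x - z)) + v * Real.exp (l * (x - b)) with hq
      have hqc : ConvexOn ℝ Set.univ q :=
        ((convex_exp (x - z)).smul hu0).add ((convex_exp (x - b)).smul hv0)
      have hq0 : q 0 = 1 := by
        simp only [hq, zero_mul, Real.exp_zero, hu, hv]; field_simp; ring
      have hql : q l0 = 1 := by
        simp only [hq, ← hP, ← hQ, hu, hv]; field_simp; ring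
      refine ⟨b, u, v, hu0, hv0, Or.inr hDb, fun l hl => ?_⟩
      rw [hEx, hEz, hEb]
      have f1 : (1 - q l) * (h l - 1) ≤ 0 := by
        rcases le_total l l0 with hll | hll
        · exact mul_nonpos_of_nonneg_of_nonpos
            (sub_nonneg.2 (convex_inside hqc hl hll hq0.le hql.le)) (sub_nonpos.2 (hin l hl hll))
        · exact mul_nonpos_of_nonpos_of_nonneg
            (sub_nonpos.2 (convex_outside hqc hl0 hll hq0.le hql.ge)) (sub_nonneg.2 (hout l hll))
      have f2 : (1 - q (-l)) * B l ≤ 0 :=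
        mul_nonpos_of_nonpos_of_nonneg
          (sub_nonpos.2 (convex_outside_left hqc (by linarith) hl0 hq0.ge hql.le)) (hBnn l)
      have g1 := mul_nonpos_of_nonneg_of_nonpos (Real.exp_pos (-(l * x))).le f1
      have g2 := mul_nonpos_of_nonneg_of_nonpos (Real.exp_pos (l * x)).le f2
      have k1 : Real.exp (-(l * z)) = Real.exp (-(l * x)) * Real.exp (l * (x - z)) := by
        rw [← Real.exp_add]; congr 1; ring
      have k2 : Real.exp (-(l * b)) = Real.exp (-(l * x)) * Real.exp (l * (x - b)) := by
        rw [← Real.exp_add]; congr 1; ring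
      have k3 : Real.exp (l * z) = Real.exp (l * x) * Real.exp (-l * (x - z)) := by
        rw [← Real.exp_add]; congr 1; ring
      have k4 : Real.exp (l * b) = Real.exp (l * x) * Real.exp (-l * (x - b)) := by
        rw [← Real.exp_add]; congr 1; ring
      rw [k1, k2, k3, k4]
      simp only [hq] at g1 g2
      linarith


/-- for a 1-D CMF kernel, if the positive combination
`ψ(θ) = Σ_ℓ c_ℓ φ(|θ-θ_ℓ|^p)` (with `Σ c_ℓ < 1`) is dominated by `φ(|·-θ'|^p)` at
each `θ_j`, then it is dominated everywhere. -/
theorem cmf_1d_domination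
    (φ : ℝ → ℝ) (hφ : IsCMF φ) (hφ0 : φ 0 = 1)
    (hφtop : Filter.Tendsto φ Filter.atTop (nhds 0))
    (p : ℝ) (hp0 : 0 < p) (hp1 : p ≤ 1)
    (t : ℕ) (θs : Fin t → ℝ) (θ' : ℝ)
    (hinj : Function.Injective θs) (hθ' : ∀ ℓ, θs ℓ ≠ θ')
    (c : Fin t → ℝ) (hc : ∀ ℓ, 0 < c ℓ) (hsum : (∑ ℓ, c ℓ) < 1)
    (hdom : ∀ j : Fin t,
      (∑ ℓ, c ℓ * φ (|θs j - θs ℓ| ^ p)) ≤ φ (|θs j - θ'| ^ p)) :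
    ∀ θ : ℝ, (∑ ℓ, c ℓ * φ (|θ - θs ℓ| ^ p)) ≤ φ (|θ - θ'| ^ p) := by
  obtain ⟨h1, h2, h3⟩ := hφ
  have hcm : ∀ n, CMn n φ := fun n => by
    have := cmn_of_isCMF_aux h1 h3 n 0
    simpa using this
  have hK : DualPos (fun x => φ (|x| ^ p)) :=
    dualPos_of_cm φ hcm h2 hφtop p hp0 hp1
  have h00 : φ (|(0:ℝ)| ^ p) = 1 := by rw [abs_zero, Real.zero_rpow hp0.ne', hφ0]
  intro θ
  rcases lt_trichotomy θ θ' with h | h | h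
  · have := core (fun x => φ (|x| ^ p)) hK h00 (fun l => θ' - θs l) c hc hsum
      (fun j => by
        have := hdom j
        simpa [abs_sub_comm] using this) (θ' - θ) (by linarith)
    simpa [abs_sub_comm] using this
  · have := dual_zero (fun x => φ (|x| ^ p)) hK h00 (fun l => θs l - θ') c hc hsum
    subst h
    simpa [h00, abs_sub_comm, hφ0, Real.zero_rpow hp0.ne'] using this
  · have := core (fun x => φ (|x| ^ p)) hK h00 (fun l => θs l - θ') c hc hsum
      (fun j => by
        have := hdom j
        simpa [abs_sub_comm] using this) (θ - θ') (by linarith)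
    simpa [abs_sub_comm] using this
end
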